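/- arXiv:1710.01418 — 15 statements merged into one kernel-verified Lean document; each statement's English description precedes it below -/
import Mathlib

section
/- Suppose R is non-negatively graded, i.e. 𝒜 i = 0 for all i < 0. Then the k-algebra homomorphism from the polynomial ring R[T] to R[u,u⁻¹] that applies π to coefficients and sends T to u is injective, and its image is exactly Q(R). In particular, Q(R) is isomorphic as an R-algebra (via π) to the polynomial ring R[T]. -/
open LaurentPolynomial

/-- `Q(R)`: the `k`-subalgebra of the Laurent polynomial ring `R[u,u⁻¹]` generated by the
image of the inclusion of constants `π = C`, the image of the coaction map `σ`, and `u = T 1`. -/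
noncomputable def Qsub {k R : Type*} [CommRing k] [CommRing R] [Algebra k R]
    (σ : R →ₐ[k] LaurentPolynomial R) : Subalgebra k (LaurentPolynomial R) :=
  Algebra.adjoin k
    (((Set.range fun r : R => (LaurentPolynomial.C r : LaurentPolynomial R)) ∪
      Set.range σ) ∪ {LaurentPolynomial.T 1})

theorem eval₂RingHom_C_T_one_eq_toLaurent {R : Type*} [CommRing R] :
    Polynomial.eval₂RingHom (LaurentPolynomial.C : R →+* LaurentPolynomial R)
      (LaurentPolynomial.T 1) = Polynomial.toLaurent :=
  Polynomial.ringHom_ext (by simp) (by simp)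

/-- On a non-negatively graded ring the coaction takes values in polynomials. -/
theorem coaction_mem_range_toLaurent {k R : Type*} [CommRing k] [CommRing R] [Algebra k R]
    (𝒜 : ℤ → Submodule k R) [GradedAlgebra 𝒜]
    (σ : R →ₐ[k] LaurentPolynomial R)
    (hσ : ∀ (i : ℤ) (r : R), r ∈ 𝒜 i →
      σ r = LaurentPolynomial.C r * LaurentPolynomial.T i)
    (hnonneg : ∀ i : ℤ, i < 0 → 𝒜 i = ⊥) (r : R) :
    σ r ∈ (Polynomial.toLaurent : Polynomial R →+* LaurentPolynomial R).range := by
  induction r using DirectSum.Decomposition.inductionOn 𝒜 with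
  | zero => simp
  | @homogeneous i m =>
    rcases lt_or_ge i 0 with hi | hi
    · have hm : (m : R) = 0 := by simpa [hnonneg i hi] using m.2
      simp [hm]
    · lift i to ℕ using hi
      rw [hσ i m m.2]
      exact ⟨Polynomial.C (m : R) * Polynomial.X ^ i, Polynomial.toLaurent_C_mul_X_pow i _⟩
  | add a b ha hb => simpa using add_mem ha hb

theorem toLaurent_mem_Qsub {k R : Type*} [CommRing k] [CommRing R] [Algebra k R]
    (σ : R →ₐ[k] LaurentPolynomial R) (p : Polynomial R) :
    Polynomial.toLaurent p ∈ Qsub σ := by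
  have hC (r : R) : LaurentPolynomial.C r ∈ Qsub σ :=
    Algebra.subset_adjoin (Or.inl (Or.inl ⟨r, rfl⟩))
  have hT : LaurentPolynomial.T 1 ∈ Qsub σ := Algebra.subset_adjoin (Or.inr rfl)
  induction p using Polynomial.induction_on' with
  | add p q hp hq => simpa using add_mem hp hq
  | monomial n r =>
    rw [← Polynomial.C_mul_X_pow_eq_monomial, map_mul, map_pow, Polynomial.toLaurent_C,
      Polynomial.toLaurent_X]
    exact mul_mem (hC r) (pow_mem hT n)

/-- If `R` is non-negatively graded, the map `R[T] → R[u,u⁻¹]` applying `π`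
to coefficients and sending `T` to `u` is injective with image exactly `Q(R)`. -/
theorem stmt1 {k R : Type*} [CommRing k] [CommRing R] [Algebra k R]
    (𝒜 : ℤ → Submodule k R) [GradedAlgebra 𝒜]
    (σ : R →ₐ[k] LaurentPolynomial R)
    (hσ : ∀ (i : ℤ) (r : R), r ∈ 𝒜 i →
      σ r = LaurentPolynomial.C r * LaurentPolynomial.T i)
    (hnonneg : ∀ i : ℤ, i < 0 → 𝒜 i = ⊥) :
    Function.Injective
      (Polynomial.eval₂RingHom (LaurentPolynomial.C : R →+* LaurentPolynomial R)
        (LaurentPolynomial.T 1)) ∧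
    Set.range
      (Polynomial.eval₂RingHom (LaurentPolynomial.C : R →+* LaurentPolynomial R)
        (LaurentPolynomial.T 1)) = (Qsub σ : Set (LaurentPolynomial R)) := by
  rw [eval₂RingHom_C_T_one_eq_toLaurent]
  refine ⟨Polynomial.toLaurent_injective, Set.Subset.antisymm ?_ fun x hx => ?_⟩
  · rintro _ ⟨p, rfl⟩
    exact toLaurent_mem_Qsub σ p
  · change x ∈ (Polynomial.toLaurent : Polynomial R →+* LaurentPolynomial R).range
    refine Algebra.adjoin_induction ?_ (fun a => ?_) (fun _ _ _ _ => add_mem)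
      (fun _ _ _ _ => mul_mem) hx
    · rintro _ ((⟨r, rfl⟩ | ⟨r, rfl⟩) | rfl)
      · exact ⟨Polynomial.C r, Polynomial.toLaurent_C r⟩
      · exact coaction_mem_range_toLaurent 𝒜 σ hσ hnonneg r
      · exact ⟨Polynomial.X, Polynomial.toLaurent_X⟩
    · exact ⟨Polynomial.C (algebraMap k R a), Polynomial.toLaurent_C _⟩
end

section
/- The k-algebra homomorphism from the polynomial ring R[T] to R[u,u⁻¹] that applies σ to coefficients and sends T to u is injective (for any ℤ-graded R). If moreover R is non-positively graded, i.e. 𝒜 i = 0 for all i > 0, then its image is exactly Q(R); in particular Q(R) is then isomorphic as an R-algebra (via σ) to the polynomial ring R[T]. -/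
open LaurentPolynomial

/-- A ring homomorphism inverting the variable and agreeing with the coaction `σ` on constants
undoes `σ`, by comparison on homogeneous elements. -/
theorem eval₂_coaction {k R : Type*} [CommRing k] [CommRing R] [Algebra k R]
    (𝒜 : ℤ → Submodule k R) [GradedAlgebra 𝒜] (σ : R →ₐ[k] LaurentPolynomial R)
    (hσ : ∀ (i : ℤ) (r : R), r ∈ 𝒜 i →
      σ r = LaurentPolynomial.C r * LaurentPolynomial.T i)
    (Φ : LaurentPolynomial R →+* LaurentPolynomial R)
    (hC : ∀ r, Φ (LaurentPolynomial.C r) = σ r)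
    (hT : ∀ n : ℤ, Φ (LaurentPolynomial.T n) = LaurentPolynomial.T (-n)) (r : R) :
    Φ (σ r) = LaurentPolynomial.C r := by
  induction r using DirectSum.Decomposition.inductionOn 𝒜 with
  | zero => simp
  | @homogeneous i m =>
    rw [hσ i m m.2, map_mul, hC, hT, hσ i m m.2, mul_assoc, ← LaurentPolynomial.T_add]
    simp
  | add a b ha hb => simp only [map_add, ha, hb]

/-- In a non-positively graded ring, constants lie in the subring generated by the image of the
coaction and the variable. -/
theorem C_mem_range_eval₂RingHom {k R : Type*} [CommRing k] [CommRing R] [Algebra k R]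
    (𝒜 : ℤ → Submodule k R) [GradedAlgebra 𝒜] (σ : R →ₐ[k] LaurentPolynomial R)
    (hσ : ∀ (i : ℤ) (r : R), r ∈ 𝒜 i →
      σ r = LaurentPolynomial.C r * LaurentPolynomial.T i)
    (hneg : ∀ i : ℤ, 0 < i → 𝒜 i = ⊥) (r : R) :
    LaurentPolynomial.C r ∈
      (Polynomial.eval₂RingHom σ.toRingHom (LaurentPolynomial.T 1)).range := by
  induction r using DirectSum.Decomposition.inductionOn 𝒜 with
  | zero => simp
  | @homogeneous i m =>
    rcases lt_or_ge 0 i with hi | hi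
    · have hm : (m : R) = 0 := by simpa [hneg i hi] using m.2
      simp [hm]
    · refine ⟨Polynomial.C (m : R) * Polynomial.X ^ (-i).toNat, ?_⟩
      have hn : (((-i).toNat : ℕ) : ℤ) = -i := Int.toNat_of_nonneg (by lia)
      simp only [Polynomial.coe_eval₂RingHom, Polynomial.C_mul_X_pow_eq_monomial,
        Polynomial.eval₂_monomial]
      change σ m * _ = _
      rw [hσ i m m.2, LaurentPolynomial.T_pow, hn, mul_assoc, ← LaurentPolynomial.T_add]
      simp
  | add a b ha hb => rw [map_add]; exact add_mem ha hb

/-- The map `R[T] → R[u,u⁻¹]` applying `σ` to coefficients and sending `T`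
to `u` is always injective; if `R` is non-positively graded, its image is exactly `Q(R)`. -/
theorem stmt2 {k R : Type*} [CommRing k] [CommRing R] [Algebra k R]
    (𝒜 : ℤ → Submodule k R) [GradedAlgebra 𝒜]
    (σ : R →ₐ[k] LaurentPolynomial R)
    (hσ : ∀ (i : ℤ) (r : R), r ∈ 𝒜 i →
      σ r = LaurentPolynomial.C r * LaurentPolynomial.T i) :
    Function.Injective
      (Polynomial.eval₂RingHom σ.toRingHom (LaurentPolynomial.T 1)) ∧
    ((∀ i : ℤ, 0 < i → 𝒜 i = ⊥) →
      Set.range (Polynomial.eval₂RingHom σ.toRingHom (LaurentPolynomial.T 1)) =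
        (Qsub σ : Set (LaurentPolynomial R))) := by
  constructor
  · let v : (LaurentPolynomial R)ˣ :=
      ⟨LaurentPolynomial.T (-1), LaurentPolynomial.T 1,
        by rw [← LaurentPolynomial.T_add]; simp, by rw [← LaurentPolynomial.T_add]; simp⟩
    let Φ := LaurentPolynomial.eval₂ σ.toRingHom v
    have hC (r : R) : Φ (LaurentPolynomial.C r) = σ r := by simp [Φ]
    have hT (n : ℤ) : Φ (LaurentPolynomial.T n) = LaurentPolynomial.T (-n) := by
      rw [LaurentPolynomial.eval₂_T]
      obtain ⟨m, rfl | rfl⟩ := n.eq_nat_or_neg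
      · simp [v, LaurentPolynomial.T_pow]
      · rw [zpow_neg, zpow_natCast, ← inv_pow, Units.val_pow_eq_pow_val]
        simp [v, LaurentPolynomial.T_pow]
    have key : Φ.comp (Polynomial.eval₂RingHom σ.toRingHom (LaurentPolynomial.T 1)) =
        (LaurentPolynomial.invert (R := R) : LaurentPolynomial R →+* LaurentPolynomial R).comp
          Polynomial.toLaurent := by
      refine Polynomial.ringHom_ext (fun r => ?_) ?_
      · simp [eval₂_coaction 𝒜 σ hσ Φ hC hT]
      · simp [hT]
    refine Function.Injective.of_comp (f := Φ) ?_
    rw [← RingHom.coe_comp, key]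
    exact LaurentPolynomial.invert.injective.comp Polynomial.toLaurent_injective
  · intro hneg
    apply Set.Subset.antisymm
    · rintro _ ⟨p, rfl⟩
      rw [SetLike.mem_coe, Polynomial.coe_eval₂RingHom, Polynomial.eval₂_eq_sum_range]
      refine sum_mem fun i _ => mul_mem ?_ (pow_mem ?_ i)
      · exact Algebra.subset_adjoin (.inl (.inr ⟨_, rfl⟩))
      · exact Algebra.subset_adjoin (.inr rfl)
    · intro x hx
      change x ∈ (Polynomial.eval₂RingHom σ.toRingHom (LaurentPolynomial.T 1)).range
      induction hx using Algebra.adjoin_induction with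
      | mem x hx =>
        rcases hx with (⟨r, rfl⟩ | ⟨r, rfl⟩) | rfl
        · exact C_mem_range_eval₂RingHom 𝒜 σ hσ hneg r
        · exact ⟨Polynomial.C r, by simp⟩
        · exact ⟨Polynomial.X, by simp⟩
      | algebraMap a => exact ⟨Polynomial.C (algebraMap k R a), by simp⟩
      | add x y _ _ hx hy => exact add_mem hx hy
      | mul x y _ _ hx hy => exact mul_mem hx hy
end

section
/- Let a ∈ ℤ and give the polynomial ring R[x] the ℤ-grading in which a monomial r·xᵐ with r ∈ 𝒜 d is homogeneous of degree d + a·m. The graded inclusion R → R[x] induces (by applying it coefficientwise to Laurent polynomials) a k-algebra homomorphism Q(R) → Q(R[x]). Then the Q(R)-algebra homomorphism from the polynomial ring Q(R)[y] to Q(R[x]) which sends y to σ(x) = x·uᵃ when a ≤ 0 (respectively sends y to π(x) = x when a ≥ 0) is bijective; i.e. Q(R[x]) is a polynomial ring in one variable over Q(R). -/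
open LaurentPolynomial

/-- Extracting coefficients of `Ψ(q)·(x·uᵇ)ᵐ` for the coefficientwise extension `Ψ` of
`R → R[x]`. -/
theorem coeff_coeff_mul_pow {R : Type*} [CommRing R]
    (Ψ : LaurentPolynomial R →+* LaurentPolynomial (Polynomial R))
    (hΨ : ∀ (r : R) (n : ℤ), Ψ (LaurentPolynomial.C r * LaurentPolynomial.T n) =
      LaurentPolynomial.C (Polynomial.C r) * LaurentPolynomial.T n)
    (b : ℤ) (q : LaurentPolynomial R) (m j : ℕ) (n : ℤ) :
    ((Ψ q * (LaurentPolynomial.C Polynomial.X * LaurentPolynomial.T b) ^ m).coeff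
      (n + b * j)).coeff j = if m = j then q.coeff n else 0 := by
  induction q using LaurentPolynomial.induction_on' with
  | add p q hp hq =>
    rw [map_add Ψ, add_mul, AddMonoidAlgebra.coeff_add, Finsupp.add_apply, Polynomial.coeff_add,
      hp, hq]
    split_ifs <;> simp
  | C_mul_T d r =>
    have h : Ψ (LaurentPolynomial.C r * LaurentPolynomial.T d) *
        (LaurentPolynomial.C Polynomial.X * LaurentPolynomial.T b) ^ m =
        AddMonoidAlgebra.single (d + b * m) (Polynomial.C r * Polynomial.X ^ m) := by
      rw [hΨ, LaurentPolynomial.single_eq_C_mul_T, LaurentPolynomial.T_add, mul_pow,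
        LaurentPolynomial.T_pow, map_mul, map_pow, mul_comm (m : ℤ) b]
      ring
    rw [h, ← LaurentPolynomial.single_eq_C_mul_T, AddMonoidAlgebra.coeff_single,
      AddMonoidAlgebra.coeff_single, Finsupp.single_apply, Finsupp.single_apply]
    by_cases hmj : m = j
    · subst hmj
      by_cases hd : d = n <;> simp [hd]
    · split_ifs <;> simp [Polynomial.coeff_X_pow, Ne.symm hmj]

/-- Give `R[x]` the grading where `r·xᵐ` (with `r ∈ 𝒜 d`) is homogeneous of
degree `d + a·m`.  The graded inclusion `R → R[x]` induces, coefficientwise on Laurent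
polynomials, a map `Q(R) → Q(R[x])`, and the `Q(R)`-algebra homomorphism
`Q(R)[y] → Q(R[x])` sending `y` to `σ(x) = x·uᵃ` (if `a ≤ 0`) resp. to `π(x) = x`
(if `a ≥ 0`) is bijective. -/
theorem stmt3 {k R : Type*} [CommRing k] [CommRing R] [Algebra k R]
    (𝒜 : ℤ → Submodule k R) [GradedAlgebra 𝒜]
    (σ : R →ₐ[k] LaurentPolynomial R)
    (hσ : ∀ (i : ℤ) (r : R), r ∈ 𝒜 i →
      σ r = LaurentPolynomial.C r * LaurentPolynomial.T i)
    (a : ℤ)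
    (ℬ : ℤ → Submodule k (Polynomial R)) [GradedAlgebra ℬ]
    (hℬ : ∀ n : ℤ, ℬ n = Submodule.span k
      {p : Polynomial R | ∃ (d : ℤ) (m : ℕ) (r : R), r ∈ 𝒜 d ∧ d + a * m = n ∧
        p = Polynomial.C r * Polynomial.X ^ m})
    (σP : Polynomial R →ₐ[k] LaurentPolynomial (Polynomial R))
    (hσP : ∀ (i : ℤ) (p : Polynomial R), p ∈ ℬ i →
      σP p = LaurentPolynomial.C p * LaurentPolynomial.T i)
    -- the coefficientwise extension of the inclusion `R → R[x]` to Laurent polynomials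
    (Ψ : LaurentPolynomial R →ₐ[k] LaurentPolynomial (Polynomial R))
    (hΨ : ∀ (r : R) (n : ℤ), Ψ (LaurentPolynomial.C r * LaurentPolynomial.T n) =
      LaurentPolynomial.C (Polynomial.C r) * LaurentPolynomial.T n)
    (hΨQ : ∀ q ∈ Qsub σ, Ψ q ∈ Qsub σP)
    -- the induced map `Q(R) → Q(R[x])`
    (F : ↥(Qsub σ) →+* ↥(Qsub σP))
    (hF : ∀ q : ↥(Qsub σ), (F q : LaurentPolynomial (Polynomial R)) =
      Ψ (q : LaurentPolynomial R))
    -- the element `y₀ = σ(x)` if `a ≤ 0`, resp. `y₀ = π(x)` if `a ≥ 0`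
    (y₀ : ↥(Qsub σP))
    (hy₀ : (y₀ : LaurentPolynomial (Polynomial R)) =
      if a ≤ 0 then LaurentPolynomial.C Polynomial.X * LaurentPolynomial.T a
      else LaurentPolynomial.C Polynomial.X) :
    Function.Bijective (Polynomial.eval₂RingHom F y₀) := by
  have hσC : ∀ r : R, σP (Polynomial.C r) = Ψ (σ r) := by
    intro r
    induction r using DirectSum.Decomposition.inductionOn 𝒜 with
    | zero => simp
    | @homogeneous i m =>
      rw [hσ i m m.2, hΨ]
      refine hσP i _ ?_
      rw [hℬ]
      exact Submodule.subset_span ⟨i, 0, m, m.2, by simp, by simp⟩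
    | add r s hr hs => rw [map_add, map_add, map_add, map_add, hr, hs]
  have hσX : σP Polynomial.X = LaurentPolynomial.C Polynomial.X * LaurentPolynomial.T a := by
    refine hσP a _ ?_
    rw [hℬ]
    exact Submodule.subset_span ⟨0, 1, 1, SetLike.GradedOne.one_mem, by simp, by simp⟩
  obtain ⟨b, hb, hb₀, hba⟩ : ∃ b : ℤ, (y₀ : LaurentPolynomial (Polynomial R)) =
      LaurentPolynomial.C Polynomial.X * LaurentPolynomial.T b ∧ b ≤ 0 ∧ b ≤ a := by
    by_cases ha : a ≤ 0
    · exact ⟨a, by rw [hy₀, if_pos ha], ha, le_rfl⟩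
    · exact ⟨0, by rw [hy₀, if_neg ha, LaurentPolynomial.T_zero, mul_one], le_rfl, by omega⟩
  set g : Polynomial (Qsub σ) →+* LaurentPolynomial (Polynomial R) :=
    (Qsub σP).val.toRingHom.comp (Polynomial.eval₂RingHom F y₀) with hg
  have hgC : ∀ q, g (Polynomial.C q) = Ψ q := fun q => by simp [hg, hF]
  have hgX : g Polynomial.X = LaurentPolynomial.C Polynomial.X * LaurentPolynomial.T b := by
    simp [hg, hb]
  constructor
  · rw [injective_iff_map_eq_zero]
    intro p hp
    have key : ∀ (p : Polynomial (Qsub σ)) (j : ℕ) (n : ℤ),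
        ((g p).coeff (n + b * j)).coeff j = (p.coeff j : LaurentPolynomial R).coeff n := by
      intro p j n
      induction p using Polynomial.induction_on' with
      | add p q hp hq =>
        rw [map_add g, AddMonoidAlgebra.coeff_add, Finsupp.add_apply, Polynomial.coeff_add, hp, hq,
          Polynomial.coeff_add, Subalgebra.coe_add, AddMonoidAlgebra.coeff_add, Finsupp.add_apply]
      | monomial m q =>
        rw [← Polynomial.C_mul_X_pow_eq_monomial, map_mul, map_pow, hgC, hgX]
        have := coeff_coeff_mul_pow Ψ.toRingHom hΨ b q m j n
        refine this.trans ?_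
        rw [Polynomial.coeff_C_mul_X_pow]
        by_cases h : m = j
        · simp [h]
        · simp [h, Ne.symm h]
    have hgp : g p = 0 := by
      rw [hg, RingHom.comp_apply, hp, map_zero]
    ext j n
    rw [← key p j n, hgp]
    simp
  · have hT : ∀ n : ℕ, (LaurentPolynomial.T n : LaurentPolynomial (Polynomial R)) ∈ g.rangeS := by
      intro n
      have h1 : (LaurentPolynomial.T 1 : LaurentPolynomial (Polynomial R)) ∈ g.rangeS := by
        refine ⟨Polynomial.C ⟨LaurentPolynomial.T 1, Algebra.subset_adjoin (Or.inr rfl)⟩, ?_⟩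
        rw [hgC]
        simpa using hΨ 1 1
      simpa [LaurentPolynomial.T_pow] using pow_mem h1 n
    have hXT : ∀ c : ℤ, b ≤ c →
        LaurentPolynomial.C Polynomial.X * LaurentPolynomial.T c ∈ g.rangeS := by
      intro c hc
      obtain ⟨n, rfl⟩ := Int.le.dest hc
      rw [LaurentPolynomial.T_add, ← mul_assoc, ← hgX]
      exact mul_mem ⟨_, rfl⟩ (hT n)
    have hCC : ∀ r : R, LaurentPolynomial.C (Polynomial.C r) ∈ g.rangeS := by
      intro r
      refine ⟨Polynomial.C ⟨LaurentPolynomial.C r,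
        Algebra.subset_adjoin (Or.inl (Or.inl ⟨r, rfl⟩))⟩, ?_⟩
      rw [hgC]
      simpa using hΨ r 0
    have hmem : ∀ f : Polynomial R →+* LaurentPolynomial (Polynomial R),
        (∀ r, f (Polynomial.C r) ∈ g.rangeS) → f Polynomial.X ∈ g.rangeS → ∀ p, f p ∈ g.rangeS := by
      intro f hC hX p
      induction p using Polynomial.induction_on' with
      | add p q hp hq => rw [map_add]; exact add_mem hp hq
      | monomial m r =>
        rw [← Polynomial.C_mul_X_pow_eq_monomial, map_mul, map_pow]
        exact mul_mem (hC r) (pow_mem hX m)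
    have hrange : ∀ v ∈ Qsub σP, v ∈ g.rangeS := by
      intro v hv
      induction hv using Algebra.adjoin_induction with
      | mem v hv =>
        rcases hv with (⟨p, rfl⟩ | ⟨p, rfl⟩) | rfl
        · exact hmem LaurentPolynomial.C hCC (by simpa using hXT 0 hb₀) p
        · refine hmem σP.toRingHom (fun r => ?_) ?_ p
          · exact ⟨Polynomial.C ⟨σ r, Algebra.subset_adjoin (Or.inl (Or.inr ⟨r, rfl⟩))⟩,
              (hgC _).trans (hσC r).symm⟩
          · exact hσX ▸ hXT a hba
        · simpa using hT 1
      | algebraMap c =>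
        exact ⟨Polynomial.C (algebraMap k (Qsub σ) c), (hgC _).trans (Ψ.commutes c)⟩
      | add x y _ _ hx hy => exact add_mem hx hy
      | mul x y _ _ hx hy => exact mul_mem hx hy
    intro v
    obtain ⟨p, hp⟩ := hrange v v.2
    exact ⟨p, Subtype.ext hp⟩
end

section
/- Let r ∈ 𝒜 d be a homogeneous element of positive degree d > 0. Then for every Laurent polynomial ξ ∈ R[u,u⁻¹] there exists n ∈ ℕ such that σ(r)ⁿ·ξ ∈ Q(R), where σ(r) = r·u^d. Consequently the inclusion Q(R) ↪ R[u,u⁻¹] induces a bijective ring homomorphism from the localization of Q(R) away from σ(r) to the localization of R[u,u⁻¹] away from σ(r). -/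
open LaurentPolynomial

/-- A subalgebra `S` of `B` and `B` itself have the same localization away from `b ∈ S` as soon as
every element of `B` is multiplied into `S` by some power of `b`. -/
theorem Subalgebra.bijective_map_away {k B : Type*} [CommRing k] [CommRing B] [Algebra k B]
    (S : Subalgebra k B) (b : B) (hb : b ∈ S) (h : ∀ x : B, ∃ n : ℕ, b ^ n * x ∈ S)
    (hle : Submonoid.powers (⟨b, hb⟩ : S) ≤ (Submonoid.powers b).comap S.val.toRingHom) :
    Function.Bijective
      (IsLocalization.map (S := Localization.Away (⟨b, hb⟩ : S))
        (M := Submonoid.powers (⟨b, hb⟩ : S)) (T := Submonoid.powers b)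
        (Localization.Away b) S.val.toRingHom hle :
        Localization.Away (⟨b, hb⟩ : S) → Localization.Away b) := by
  constructor
  · rw [injective_iff_map_eq_zero]
    intro x hx
    obtain ⟨s, y, rfl⟩ := IsLocalization.exists_mk'_eq (Submonoid.powers (⟨b, hb⟩ : S)) x
    rw [IsLocalization.map_mk', IsLocalization.mk'_eq_zero_iff] at hx
    rw [IsLocalization.mk'_eq_zero_iff]
    obtain ⟨⟨_, n, rfl⟩, hn⟩ := hx
    exact ⟨⟨_, n, rfl⟩, Subtype.ext hn⟩
  · intro x
    obtain ⟨ξ, ⟨_, m, rfl⟩, rfl⟩ := IsLocalization.exists_mk'_eq (Submonoid.powers b) x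
    obtain ⟨n, hn⟩ := h ξ
    refine ⟨IsLocalization.mk' _ (⟨b ^ n * ξ, hn⟩ : S)
      (⟨_, n + m, rfl⟩ : Submonoid.powers (⟨b, hb⟩ : S)), ?_⟩
    rw [IsLocalization.map_mk', IsLocalization.mk'_eq_iff_eq]
    congr 1
    change b ^ m * (b ^ n * ξ) = b ^ (n + m) * ξ
    ring

theorem C_mul_T_natCast_mem_Qsub {k R : Type*} [CommRing k] [CommRing R] [Algebra k R]
    (σ : R →ₐ[k] LaurentPolynomial R) (a : R) (m : ℕ) :
    (LaurentPolynomial.C a * LaurentPolynomial.T m : LaurentPolynomial R) ∈ Qsub σ := by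
  have hT : (LaurentPolynomial.T m : LaurentPolynomial R) = LaurentPolynomial.T 1 ^ m := by
    rw [LaurentPolynomial.T_pow, mul_one]
  have hCa : (LaurentPolynomial.C a : LaurentPolynomial R) ∈ Qsub σ :=
    Algebra.subset_adjoin (Set.mem_union_left _ (Set.mem_union_left _ ⟨a, rfl⟩))
  have hT1 : (LaurentPolynomial.T 1 : LaurentPolynomial R) ∈ Qsub σ :=
    Algebra.subset_adjoin (Set.mem_union_right _ (Set.mem_singleton _))
  rw [hT]
  exact mul_mem hCa (pow_mem hT1 m)

theorem exists_pow_mul_mem_Qsub {k R : Type*} [CommRing k] [CommRing R] [Algebra k R]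
    (σ : R →ₐ[k] LaurentPolynomial R) {d : ℤ} (hd : 0 < d) {r : R}
    (hr : σ r = LaurentPolynomial.C r * LaurentPolynomial.T d) (hmem : σ r ∈ Qsub σ)
    (ξ : LaurentPolynomial R) : ∃ n : ℕ, σ r ^ n * ξ ∈ Qsub σ := by
  induction ξ using LaurentPolynomial.induction_on' with
  | add p q hp hq =>
    obtain ⟨n, hn⟩ := hp
    obtain ⟨m, hm⟩ := hq
    refine ⟨n + m, ?_⟩
    have e : σ r ^ (n + m) * (p + q) =
        σ r ^ m * (σ r ^ n * p) + σ r ^ n * (σ r ^ m * q) := by ring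
    rw [e]
    exact add_mem (mul_mem (pow_mem hmem m) hn) (mul_mem (pow_mem hmem n) hm)
  | C_mul_T j a =>
    refine ⟨j.natAbs, ?_⟩
    obtain ⟨m, hm⟩ : ∃ m : ℕ, (j.natAbs : ℤ) * d + j = m :=
      Int.eq_ofNat_of_zero_le (by nlinarith [neg_abs_le j, abs_nonneg j, Int.natCast_natAbs j])
    have e : σ r ^ j.natAbs * (LaurentPolynomial.C a * LaurentPolynomial.T j) =
        LaurentPolynomial.C (r ^ j.natAbs * a) * LaurentPolynomial.T m := by
      rw [hr, ← hm, LaurentPolynomial.T_add, mul_pow, LaurentPolynomial.T_pow, map_mul, map_pow]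
      ring
    rw [e]
    exact C_mul_T_natCast_mem_Qsub σ _ m


/-- For a homogeneous element `r` of positive degree `d > 0`, every Laurent
polynomial `ξ` satisfies `σ(r)ⁿ·ξ ∈ Q(R)` for some `n`, and consequently the inclusion
`Q(R) ↪ R[u,u⁻¹]` induces a bijection on localizations away from `σ(r)`. -/
theorem stmt5 {k R : Type*} [CommRing k] [CommRing R] [Algebra k R]
    (𝒜 : ℤ → Submodule k R) [GradedAlgebra 𝒜]
    (σ : R →ₐ[k] LaurentPolynomial R)
    (hσ : ∀ (i : ℤ) (r : R), r ∈ 𝒜 i →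
      σ r = LaurentPolynomial.C r * LaurentPolynomial.T i)
    (d : ℤ) (hd : 0 < d) (r : R) (hr : r ∈ 𝒜 d)
    (hmem : σ r ∈ Qsub σ) :
    (∀ ξ : LaurentPolynomial R, ∃ n : ℕ, σ r ^ n * ξ ∈ Qsub σ) ∧
    Function.Bijective
      (IsLocalization.map (S := Localization.Away (⟨σ r, hmem⟩ : Qsub σ))
        (M := Submonoid.powers (⟨σ r, hmem⟩ : Qsub σ))
        (T := Submonoid.powers (σ r))
        (Localization.Away (σ r)) (Qsub σ).val.toRingHom
        (Submonoid.powers_le.mpr (Submonoid.mem_comap.mpr (Submonoid.mem_powers _))) :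
        Localization.Away (⟨σ r, hmem⟩ : Qsub σ) → Localization.Away (σ r)) := by
  have h := exists_pow_mul_mem_Qsub σ hd (hσ d r hr) hmem
  exact ⟨h, (Qsub σ).bijective_map_away (σ r) hmem h _⟩
end

section
/- Let r ∈ 𝒜 d be a homogeneous element of negative degree d < 0. Then for every Laurent polynomial ξ ∈ R[u,u⁻¹] there exists n ∈ ℕ such that π(r)ⁿ·ξ ∈ Q(R), where π(r) = r is the constant Laurent polynomial. Consequently the inclusion Q(R) ↪ R[u,u⁻¹] induces a bijective ring homomorphism from the localization of Q(R) away from π(r) to the localization of R[u,u⁻¹] away from π(r). -/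
open LaurentPolynomial

/-- A ring homomorphism `f : A →+* B` induces a bijection on localizations at `M` and `f(M)` as
soon as it is injective and every element of `B` is carried into the range of `f` by some
element of `f(M)`. -/
theorem IsLocalization.map_bijective_of_exists_mul_mem_range {A B : Type*} [CommRing A]
    [CommRing B] (f : A →+* B) (M : Submonoid A) (N : Submonoid B) (S S' : Type*)
    [CommRing S] [Algebra A S] [IsLocalization M S]
    [CommRing S'] [Algebra B S'] [IsLocalization N S']
    (hMN : M ≤ N.comap f) (hNM : N ≤ M.map f) (hf : Function.Injective f)
    (hrange : ∀ b : B, ∃ m ∈ M, f m * b ∈ f.range) :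
    Function.Bijective (IsLocalization.map (S := S) (M := M) (T := N) S' f hMN) := by
  constructor
  · rw [injective_iff_map_eq_zero]
    intro x hx
    obtain ⟨a, s, rfl⟩ := IsLocalization.exists_mk'_eq M x
    rw [IsLocalization.map_mk', IsLocalization.mk'_eq_zero_iff] at hx
    obtain ⟨⟨t, ht⟩, hta⟩ := hx
    obtain ⟨m, hm, rfl⟩ := hNM ht
    rw [IsLocalization.mk'_eq_zero_iff]
    refine ⟨⟨m, hm⟩, hf ?_⟩
    simpa using hta
  · intro y
    obtain ⟨b, ⟨t, ht⟩, rfl⟩ := IsLocalization.exists_mk'_eq N y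
    obtain ⟨s, hs, rfl⟩ := hNM ht
    obtain ⟨m, hm, a, ha⟩ := hrange b
    refine ⟨IsLocalization.mk' S a (⟨m * s, M.mul_mem hm hs⟩ : M), ?_⟩
    rw [IsLocalization.map_mk', IsLocalization.mk'_eq_iff_eq]
    congr 1
    simp only [map_mul, ha]
    ring

section Qsub

variable {k R : Type*} [CommRing k] [CommRing R] [Algebra k R]
  (σ : R →ₐ[k] LaurentPolynomial R)

theorem C_mem_Qsub (a : R) : (C a : LaurentPolynomial R) ∈ Qsub σ :=
  Algebra.subset_adjoin (Or.inl (Or.inl ⟨a, rfl⟩))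

theorem apply_mem_Qsub (a : R) : σ a ∈ Qsub σ :=
  Algebra.subset_adjoin (Or.inl (Or.inr ⟨a, rfl⟩))

theorem T_natCast_mem_Qsub (n : ℕ) : (T (n : ℤ) : LaurentPolynomial R) ∈ Qsub σ := by
  have h : (T 1 : LaurentPolynomial R) ∈ Qsub σ := Algebra.subset_adjoin (Or.inr rfl)
  simpa [T_pow] using pow_mem h n

variable {σ} {d : ℤ} {r : R}

theorem C_pow_natAbs_mul_T_mem_Qsub (hσr : σ r = C r * T d) (hd : d < 0) (n : ℤ) :
    (C r : LaurentPolynomial R) ^ n.natAbs * T n ∈ Qsub σ := by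
  obtain ⟨j, hj⟩ : ∃ j : ℕ, n = n.natAbs * d + j := by
    refine ⟨(n - n.natAbs * d).toNat, ?_⟩
    have : (n.natAbs : ℤ) * d ≤ n := by
      have := Int.natCast_nonneg n.natAbs
      have : -(n.natAbs : ℤ) ≤ n := by lia
      nlinarith
    lia
  have h := mul_mem (pow_mem (apply_mem_Qsub σ r) n.natAbs) (T_natCast_mem_Qsub σ j)
  rwa [hσr, mul_pow, T_pow, mul_assoc, ← T_add, ← hj] at h

theorem exists_C_pow_mul_mem_Qsub (hσr : σ r = C r * T d) (hd : d < 0)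
    (ξ : LaurentPolynomial R) : ∃ n : ℕ, (C r : LaurentPolynomial R) ^ n * ξ ∈ Qsub σ := by
  induction ξ using LaurentPolynomial.induction_on' with
  | add p q hp hq =>
    obtain ⟨m, hm⟩ := hp
    obtain ⟨n, hn⟩ := hq
    refine ⟨m + n, ?_⟩
    have h := add_mem (mul_mem (pow_mem (C_mem_Qsub σ r) n) hm)
      (mul_mem (pow_mem (C_mem_Qsub σ r) m) hn)
    convert h using 1
    ring
  | C_mul_T n a =>
    refine ⟨n.natAbs, ?_⟩
    rw [mul_left_comm]
    exact mul_mem (C_mem_Qsub σ a) (C_pow_natAbs_mul_T_mem_Qsub hσr hd n)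

end Qsub

/-- For a homogeneous element `r` of negative degree `d < 0`, every Laurent
polynomial `ξ` satisfies `π(r)ⁿ·ξ ∈ Q(R)` for some `n`, and consequently the inclusion
`Q(R) ↪ R[u,u⁻¹]` induces a bijection on localizations away from `π(r)`. -/
theorem stmt6 {k R : Type*} [CommRing k] [CommRing R] [Algebra k R]
    (𝒜 : ℤ → Submodule k R) [GradedAlgebra 𝒜]
    (σ : R →ₐ[k] LaurentPolynomial R)
    (hσ : ∀ (i : ℤ) (r : R), r ∈ 𝒜 i →
      σ r = LaurentPolynomial.C r * LaurentPolynomial.T i)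
    (d : ℤ) (hd : d < 0) (r : R) (hr : r ∈ 𝒜 d)
    (hmem : (LaurentPolynomial.C r : LaurentPolynomial R) ∈ Qsub σ) :
    (∀ ξ : LaurentPolynomial R, ∃ n : ℕ, (LaurentPolynomial.C r : LaurentPolynomial R) ^ n * ξ ∈ Qsub σ) ∧
    Function.Bijective
      (IsLocalization.map (S := Localization.Away (⟨LaurentPolynomial.C r, hmem⟩ : Qsub σ))
        (M := Submonoid.powers (⟨LaurentPolynomial.C r, hmem⟩ : Qsub σ))
        (T := Submonoid.powers (LaurentPolynomial.C r : LaurentPolynomial R))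
        (Localization.Away (LaurentPolynomial.C r : LaurentPolynomial R)) (Qsub σ).val.toRingHom
        (Submonoid.powers_le.mpr (Submonoid.mem_comap.mpr (Submonoid.mem_powers _))) :
        Localization.Away (⟨LaurentPolynomial.C r, hmem⟩ : Qsub σ) → Localization.Away (LaurentPolynomial.C r : LaurentPolynomial R)) := by
  have hξ := exists_C_pow_mul_mem_Qsub (hσ d r hr) hd
  refine ⟨hξ, IsLocalization.map_bijective_of_exists_mul_mem_range _ _ _ _ _ _ ?_
    Subtype.val_injective ?_⟩
  · exact Submonoid.powers_le.mpr ⟨_, Submonoid.mem_powers _, rfl⟩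
  · intro ξ
    obtain ⟨n, hn⟩ := hξ ξ
    exact ⟨_, ⟨n, rfl⟩, ⟨_, hn⟩, by simp⟩
end

section
/- Let I⁺ (respectively I⁻) denote the ideal of R generated by all homogeneous elements of positive (respectively negative) degree. Then for every x ∈ R: σ(x) lies in the ideal of Q(R) generated by u if and only if x ∈ I⁺; and π(x) lies in the ideal of Q(R) generated by u if and only if x ∈ I⁻. That is, I⁺ = σ⁻¹(uQ(R)) and I⁻ = π⁻¹(uQ(R)). -/
open LaurentPolynomial

section GradedIdeals

variable {k R : Type*} [CommRing k] [CommRing R] [Algebra k R]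

/-- The ideal of `R` generated by the homogeneous elements of degree at most `j`. -/
def degreeLEIdeal (𝒜 : ℤ → Submodule k R) (j : ℤ) : Ideal R :=
  Ideal.span {y : R | ∃ i : ℤ, i ≤ j ∧ y ∈ 𝒜 i}

theorem mem_degreeLEIdeal {𝒜 : ℤ → Submodule k R} {i j : ℤ} (hij : i ≤ j) {r : R}
    (hr : r ∈ 𝒜 i) : r ∈ degreeLEIdeal 𝒜 j :=
  Ideal.subset_span ⟨i, hij, hr⟩

variable (𝒜 : ℤ → Submodule k R) [GradedAlgebra 𝒜]

theorem degreeLEIdeal_eq_top {j : ℤ} (hj : 0 ≤ j) : degreeLEIdeal 𝒜 j = ⊤ :=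
  (Ideal.eq_top_iff_one _).2 (mem_degreeLEIdeal hj SetLike.GradedOne.one_mem)

theorem degreeLEIdeal_mul_le (i j : ℤ) :
    degreeLEIdeal 𝒜 i * degreeLEIdeal 𝒜 j ≤ degreeLEIdeal 𝒜 (i + j) := by
  rw [degreeLEIdeal, degreeLEIdeal, Ideal.span_mul_span', Ideal.span_le]
  rintro _ ⟨a, ⟨m, hm, ha⟩, b, ⟨n, hn, hb⟩, rfl⟩
  exact mem_degreeLEIdeal (add_le_add hm hn) (SetLike.GradedMul.mul_mem ha hb)

/-- The degree `i` component of an element of the ideal generated in degrees less than `i` lies in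
the ideal generated by the homogeneous elements of positive degree. -/
theorem decompose_mem_span_pos {i : ℤ} {z : R} (hz : z ∈ degreeLEIdeal 𝒜 (i - 1)) :
    (DirectSum.decompose 𝒜 z i : R) ∈ Ideal.span {y : R | ∃ i : ℤ, 0 < i ∧ y ∈ 𝒜 i} := by
  suffices ∀ r : R, (DirectSum.decompose 𝒜 (r * z) i : R) ∈
      Ideal.span {y : R | ∃ i : ℤ, 0 < i ∧ y ∈ 𝒜 i} by simpa using this 1
  induction hz using Submodule.span_induction with
  | mem y hy =>
    obtain ⟨m, hm, hy⟩ := hy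
    intro r
    obtain ⟨d, rfl⟩ : ∃ d, i = d + m := ⟨i - m, by ring⟩
    rw [DirectSum.coe_decompose_mul_add_of_right_mem 𝒜 hy]
    exact Ideal.mul_mem_right _ _ (Ideal.subset_span ⟨d, by lia, SetLike.coe_mem _⟩)
  | zero => simp
  | add a b _ _ ha hb =>
    intro r
    rw [mul_add, DirectSum.decompose_add, DirectSum.add_apply, Submodule.coe_add]
    exact add_mem (ha r) (hb r)
  | smul s a _ ha =>
    intro r
    rw [smul_eq_mul, ← mul_assoc]
    exact ha (r * s)

variable {σ : R →ₐ[k] LaurentPolynomial R}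

theorem coeff_coaction (hσ : ∀ (i : ℤ) (r : R), r ∈ 𝒜 i → σ r = C r * T i) (x : R) (j : ℤ) :
    (σ x).coeff j = DirectSum.decompose 𝒜 x j := by
  induction x using DirectSum.Decomposition.inductionOn 𝒜 with
  | zero => simp
  | @homogeneous i m =>
    rw [hσ i m m.2, ← single_eq_C_mul_T, AddMonoidAlgebra.coeff_single]
    obtain rfl | hij := eq_or_ne i j
    · simp
    · rw [DirectSum.decompose_of_mem_ne 𝒜 m.2 hij, Finsupp.single_eq_of_ne hij.symm]
  | add a b ha hb => simp [ha, hb]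

theorem coeff_mem_degreeLEIdeal (hσ : ∀ (i : ℤ) (r : R), r ∈ 𝒜 i → σ r = C r * T i)
    {f : LaurentPolynomial R} (hf : f ∈ Qsub σ) (j : ℤ) : f.coeff j ∈ degreeLEIdeal 𝒜 j := by
  have hC (r : R) (j : ℤ) : (C r).coeff j ∈ degreeLEIdeal 𝒜 j := by
    rw [C_apply]
    split_ifs with h
    · simp [degreeLEIdeal_eq_top 𝒜 h.ge]
    · exact zero_mem _
  induction hf using Algebra.adjoin_induction generalizing j with
  | mem f hf =>
    obtain (⟨r, rfl⟩ | ⟨r, rfl⟩) | rfl := hf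
    · exact hC r j
    · rw [coeff_coaction 𝒜 hσ]
      exact mem_degreeLEIdeal le_rfl (SetLike.coe_mem _)
    · rw [T_apply]
      split_ifs with h
      · simp [degreeLEIdeal_eq_top 𝒜 (show 0 ≤ j by lia)]
      · exact zero_mem _
  | algebraMap r => exact hC (algebraMap k R r) j
  | add f g _ _ hf hg => exact add_mem (hf j) (hg j)
  | mul f g _ _ hf hg =>
    rw [AddMonoidAlgebra.coeff_mul]
    refine Ideal.sum_mem _ fun a _ => Ideal.sum_mem _ fun b _ => ?_
    dsimp only
    split_ifs with h
    · exact h ▸ degreeLEIdeal_mul_le 𝒜 a b (Ideal.mul_mem_mul (hf a) (hg b))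
    · exact zero_mem _

theorem coeff_T_one_mul (f : LaurentPolynomial R) (j : ℤ) :
    (T 1 * f).coeff j = f.coeff (j - 1) := by
  rw [T, AddMonoidAlgebra.coeff_single_mul_apply, one_mul, neg_add_eq_sub]

theorem coeff_mem_of_mem_span_T (hσ : ∀ (i : ℤ) (r : R), r ∈ 𝒜 i → σ r = C r * T i)
    (hT : T 1 ∈ Qsub σ) {q : Qsub σ} (hq : q ∈ Ideal.span {(⟨T 1, hT⟩ : Qsub σ)}) (j : ℤ) :
    (q : LaurentPolynomial R).coeff j ∈ degreeLEIdeal 𝒜 (j - 1) := by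
  obtain ⟨p, rfl⟩ := Ideal.mem_span_singleton'.1 hq
  rw [mul_comm, MulMemClass.coe_mul, coeff_T_one_mul]
  exact coeff_mem_degreeLEIdeal 𝒜 hσ p.2 (j - 1)

theorem T_natCast_mem (hT : T 1 ∈ Qsub σ) (n : ℕ) : T (n : ℤ) ∈ Qsub σ := by
  simpa [T_pow] using pow_mem hT n

end GradedIdeals

/-- With `I⁺` (resp. `I⁻`) the ideal of `R` generated by the homogeneous
elements of positive (resp. negative) degree: `σ(x)` lies in the ideal of `Q(R)` generated by
`u` iff `x ∈ I⁺`, and `π(x)` lies in the ideal of `Q(R)` generated by `u` iff `x ∈ I⁻`. -/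
theorem stmt7 {k R : Type*} [CommRing k] [CommRing R] [Algebra k R]
    (𝒜 : ℤ → Submodule k R) [GradedAlgebra 𝒜]
    (σ : R →ₐ[k] LaurentPolynomial R)
    (hσ : ∀ (i : ℤ) (r : R), r ∈ 𝒜 i →
      σ r = LaurentPolynomial.C r * LaurentPolynomial.T i)
    (hσmem : ∀ x : R, σ x ∈ Qsub σ)
    (hCmem : ∀ x : R, (LaurentPolynomial.C x : LaurentPolynomial R) ∈ Qsub σ)
    (hT : (LaurentPolynomial.T 1 : LaurentPolynomial R) ∈ Qsub σ)
    (x : R) :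
    ((⟨σ x, hσmem x⟩ : Qsub σ) ∈
        Ideal.span {(⟨LaurentPolynomial.T 1, hT⟩ : Qsub σ)} ↔
      x ∈ Ideal.span {y : R | ∃ i : ℤ, 0 < i ∧ y ∈ 𝒜 i}) ∧
    ((⟨LaurentPolynomial.C x, hCmem x⟩ : Qsub σ) ∈
        Ideal.span {(⟨LaurentPolynomial.T 1, hT⟩ : Qsub σ)} ↔
      x ∈ Ideal.span {y : R | ∃ i : ℤ, i < 0 ∧ y ∈ 𝒜 i}) := by
  constructor <;> constructor
  · intro h
    classical
    rw [← DirectSum.sum_support_decompose 𝒜 x]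
    refine Ideal.sum_mem _ fun i _ => ?_
    have hi := coeff_mem_of_mem_span_T 𝒜 hσ hT h i
    rw [coeff_coaction 𝒜 hσ] at hi
    simpa using decompose_mem_span_pos 𝒜 hi
  · suffices Ideal.span {y : R | ∃ i : ℤ, 0 < i ∧ y ∈ 𝒜 i} ≤
        (Ideal.span {(⟨T 1, hT⟩ : Qsub σ)}).comap (σ.codRestrict _ hσmem) from fun h => this h
    rw [Ideal.span_le]
    rintro y ⟨i, hi, hy⟩
    obtain ⟨n, rfl⟩ : ∃ n : ℕ, i = n + 1 := ⟨(i - 1).toNat, by lia⟩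
    refine Ideal.mem_span_singleton'.2
      ⟨⟨C y * T n, mul_mem (hCmem y) (T_natCast_mem hT n)⟩, Subtype.ext ?_⟩
    change C y * T n * T 1 = σ y
    rw [hσ _ y hy, mul_T_assoc]
  · intro h
    have h0 := coeff_mem_of_mem_span_T 𝒜 hσ hT h 0
    rw [C_apply, if_pos rfl] at h0
    refine Ideal.span_mono ?_ h0
    rintro y ⟨i, hi, hy⟩
    exact ⟨i, by lia, hy⟩
  · suffices Ideal.span {y : R | ∃ i : ℤ, i < 0 ∧ y ∈ 𝒜 i} ≤
        (Ideal.span {(⟨T 1, hT⟩ : Qsub σ)}).comap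
          ((C : R →+* LaurentPolynomial R).codRestrict (Qsub σ) hCmem) from fun h => this h
    rw [Ideal.span_le]
    rintro y ⟨i, hi, hy⟩
    obtain ⟨n, rfl⟩ : ∃ n : ℕ, i = -(n + 1) := ⟨(-i - 1).toNat, by lia⟩
    refine Ideal.mem_span_singleton'.2
      ⟨⟨σ y * T n, mul_mem (hσmem y) (T_natCast_mem hT n)⟩, Subtype.ext ?_⟩
    change σ y * T n * T 1 = C y
    rw [hσ _ y hy, mul_T_assoc, mul_T_assoc, neg_add_cancel, T_zero, mul_one]
end

section
/- Let R = k[X_i : i ∈ ι] be a polynomial ring over k in finitely many variables, graded by a weight function w : ι → ℤ (a monomial ∏ X_i^{m_i} is homogeneous of degree Σ w(i)·m_i). Then the family of elements of R[u,u⁻¹] consisting of u, the elements π(X_i) = X_i for those i with w(i) ≥ 0, and the elements σ(X_j) = X_j·u^{w(j)} for those j with w(j) < 0, is algebraically independent over k and generates Q(R) as a k-algebra; in particular Q(R) is a polynomial ring over k in (card ι) + 1 variables. -/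
open LaurentPolynomial

open MvPolynomial in
theorem MvPolynomial.algHom_mem_of_forall_X_mem {k ι A : Type*} [CommRing k] [CommRing A]
    [Algebra k A] (S : Subalgebra k A) (g : MvPolynomial ι k →ₐ[k] A) (h : ∀ i, g (X i) ∈ S)
    (p : MvPolynomial ι k) : g p ∈ S := by
  induction p using MvPolynomial.induction_on with
  | C a =>
    rw [← MvPolynomial.algebraMap_eq, AlgHom.commutes]
    exact S.algebraMap_mem a
  | add p q hp hq => rw [map_add]; exact S.add_mem hp hq
  | mul_X p i hp => rw [map_mul]; exact S.mul_mem hp (h i)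

/-- In `k[X][u,u⁻¹]`, the element `u` together with the twists `Xᵢ·u^(n i)` of the variables
by arbitrary powers of `u` is algebraically independent. -/
theorem LaurentPolynomial.algebraicIndependent_C_X_mul_T {k ι : Type*} [CommRing k] (n : ι → ℤ) :
    AlgebraicIndependent k
      (fun o : Option ι => o.elim (T 1 : LaurentPolynomial (MvPolynomial ι k))
        (fun i => C (MvPolynomial.X i) * T (n i))) := by
  let u : (LaurentPolynomial (MvPolynomial ι k))ˣ :=
    ⟨T 1, T (-1), by rw [← T_add]; rfl, by rw [← T_add]; rfl⟩
  let untwist : LaurentPolynomial (MvPolynomial ι k) →+* LaurentPolynomial (MvPolynomial ι k) :=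
    LaurentPolynomial.eval₂
      (MvPolynomial.aeval (R := k) fun i =>
        (C (MvPolynomial.X i) * T (-n i) :
          LaurentPolynomial (MvPolynomial ι k))).toRingHom
      u
  have hu (m : ℤ) : ((u ^ m : (LaurentPolynomial (MvPolynomial ι k))ˣ) :
      LaurentPolynomial (MvPolynomial ι k)) = T m := by
    induction m with
    | zero => simp
    | succ m ih => rw [zpow_add_one, Units.val_mul, ih, T_add]
    | pred m ih => rw [zpow_sub_one, Units.val_mul, ih, T_sub]; rfl
  have hT (m : ℤ) : untwist (T m) = T m := by simp [untwist, hu]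
  have hX (i : ι) : untwist (C (MvPolynomial.X i)) = C (MvPolynomial.X i) * T (-n i) := by
    simp [untwist]
  have hcomp : (untwist.comp (MvPolynomial.aeval (R := k)
      (fun o : Option ι => o.elim (T 1 : LaurentPolynomial (MvPolynomial ι k))
        (fun i => C (MvPolynomial.X i) * T (n i)))).toRingHom) =
      Polynomial.toLaurent.comp (MvPolynomial.optionEquivLeft k ι).toRingEquiv.toRingHom := by
    refine MvPolynomial.ringHom_ext (fun a => ?_) (fun o => ?_)
    · simp [untwist, LaurentPolynomial.algebraMap_apply]
    · cases o with
      | none => simp [hT]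
      | some i =>
        have h : T (-n i) * T (n i) = (1 : LaurentPolynomial (MvPolynomial ι k)) := by
          rw [← T_add, neg_add_cancel, T_zero]
        simp [hT, hX, mul_assoc, h]
  have hinj : Function.Injective (Polynomial.toLaurent.comp
      (MvPolynomial.optionEquivLeft k ι).toRingEquiv.toRingHom) :=
    Polynomial.toLaurent_injective.comp (MvPolynomial.optionEquivLeft k ι).injective
  rw [← hcomp] at hinj
  exact fun p q h => hinj (congrArg untwist h)

/-- Let `R = k[Xᵢ : i ∈ ι]` with finitely many variables, graded by a weight
function `w : ι → ℤ`.  The family consisting of `u`, the `π(Xᵢ) = Xᵢ` for `w i ≥ 0`, and the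
`σ(Xⱼ) = Xⱼ·u^(w j)` for `w j < 0`, is algebraically independent over `k` and generates
`Q(R)` as a `k`-algebra. -/
theorem stmt8 {k : Type*} [CommRing k] {ι : Type*} [Finite ι] (w : ι → ℤ)
    (σ : MvPolynomial ι k →ₐ[k] LaurentPolynomial (MvPolynomial ι k))
    (hσ : ∀ (i : ℤ) (r : MvPolynomial ι k),
      r ∈ MvPolynomial.weightedHomogeneousSubmodule k w i →
      σ r = LaurentPolynomial.C r * LaurentPolynomial.T i) :
    AlgebraicIndependent k
      (fun o : Option ι => Option.elim o (LaurentPolynomial.T 1 : LaurentPolynomial (MvPolynomial ι k))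
        (fun i => if 0 ≤ w i then LaurentPolynomial.C (MvPolynomial.X i)
          else LaurentPolynomial.C (MvPolynomial.X i) * LaurentPolynomial.T (w i))) ∧
    Algebra.adjoin k
      (Set.range (fun o : Option ι => Option.elim o (LaurentPolynomial.T 1 : LaurentPolynomial (MvPolynomial ι k))
        (fun i => if 0 ≤ w i then LaurentPolynomial.C (MvPolynomial.X i)
          else LaurentPolynomial.C (MvPolynomial.X i) * LaurentPolynomial.T (w i)))) =
      Qsub σ := by
  have hfam : (fun o : Option ι => Option.elim o
      (LaurentPolynomial.T 1 : LaurentPolynomial (MvPolynomial ι k))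
      (fun i => if 0 ≤ w i then LaurentPolynomial.C (MvPolynomial.X i)
        else LaurentPolynomial.C (MvPolynomial.X i) * LaurentPolynomial.T (w i))) =
      fun o => o.elim (LaurentPolynomial.T 1) (fun i =>
        LaurentPolynomial.C (MvPolynomial.X i) * LaurentPolynomial.T (min 0 (w i))) := by
    funext o
    cases o with
    | none => rfl
    | some i =>
      by_cases h : 0 ≤ w i
      · simp [h]
      · simp [h, min_eq_right (not_le.mp h).le]
  have hσX (i : ι) : σ (MvPolynomial.X i) =
      LaurentPolynomial.C (MvPolynomial.X i) * LaurentPolynomial.T (w i) :=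
    hσ _ _ ((MvPolynomial.mem_weightedHomogeneousSubmodule _ _ _ _).2
      (MvPolynomial.isWeightedHomogeneous_X k w i))
  refine ⟨hfam ▸ LaurentPolynomial.algebraicIndependent_C_X_mul_T _, le_antisymm ?_ ?_⟩
  · refine Algebra.adjoin_le ?_
    rintro _ ⟨_ | i, rfl⟩
    · exact Algebra.subset_adjoin (Or.inr rfl)
    · dsimp only [Option.elim]
      split_ifs
      · exact Algebra.subset_adjoin (Or.inl (Or.inl ⟨_, rfl⟩))
      · exact Algebra.subset_adjoin (Or.inl (Or.inr ⟨_, hσX i⟩))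
  · rw [hfam]
    set S := Algebra.adjoin k (Set.range fun o : Option ι => o.elim
      (LaurentPolynomial.T 1 : LaurentPolynomial (MvPolynomial ι k)) (fun i =>
        LaurentPolynomial.C (MvPolynomial.X i) * LaurentPolynomial.T (min 0 (w i))))
    have hu : (LaurentPolynomial.T 1 : LaurentPolynomial (MvPolynomial ι k)) ∈ S :=
      Algebra.subset_adjoin ⟨none, rfl⟩
    have hX (i : ι) (m : ℤ) (hm : min 0 (w i) ≤ m) :
        LaurentPolynomial.C (MvPolynomial.X i) * LaurentPolynomial.T m ∈ S := by
      obtain ⟨d, rfl⟩ := Int.le.dest hm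
      have hd : (LaurentPolynomial.T (d : ℤ) : LaurentPolynomial (MvPolynomial ι k)) ∈ S := by
        simpa [LaurentPolynomial.T_pow] using S.pow_mem hu d
      rw [LaurentPolynomial.T_add, ← mul_assoc]
      exact S.mul_mem (Algebra.subset_adjoin ⟨some i, rfl⟩) hd
    refine Algebra.adjoin_le ?_
    rintro _ ((⟨r, rfl⟩ | ⟨r, rfl⟩) | rfl)
    · refine MvPolynomial.algHom_mem_of_forall_X_mem S
        (IsScalarTower.toAlgHom k (MvPolynomial ι k) _) (fun i => ?_) r
      simpa using hX i 0 (min_le_left _ _)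
    · exact MvPolynomial.algHom_mem_of_forall_X_mem S σ
        (fun i => hσX i ▸ hX i _ (min_le_right _ _)) r
    · exact hu
end

section
/- Let R = k[X_i : i ∈ ι] be a polynomial ring over k in finitely many variables, graded by a weight function w : ι → ℤ. Let p, s : R → Q(R) be the k-algebra homomorphisms obtained by corestricting π and σ to Q(R), and regard Q(R) as an R-module via p (denoted Q(R)_p) and via s (denoted Q(R)_s). Then Tor_i^R(Q(R)_p, Q(R)_s) = 0 for all i > 0. -/
open LaurentPolynomial CategoryTheory

set_option synthInstance.maxHeartbeats 1000000
set_option maxHeartbeats 1000000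

open scoped MonoidalCategory TensorProduct

namespace ModuleCat

variable {B R : Type} [CommRing B] [CommRing R]

instance additive_extendScalars (f : B →+* R) : (extendScalars.{0, 0, 0} f).Additive :=
  (extendRestrictScalarsAdj.{0, 0, 0} f).left_adjoint_additive

instance preservesProjectiveObjects_extendScalars (f : B →+* R) :
    (extendScalars.{0, 0, 0} f).PreservesProjectiveObjects where
  projective_obj {P} hP := (extendRestrictScalarsAdj.{0, 0, 0} f).map_projective P hP

/-- If `X` is flat over `B`, then `N ↦ X ⊗[R] (R ⊗[B] N)` preserves exactness. -/
theorem exact_map_extendScalars_comp_tensorLeft (f : B →+* R) (X : ModuleCat.{0} R)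
    (hX : Module.Flat B ((restrictScalars f).obj X)) (S : ShortComplex (ModuleCat.{0} B))
    (hS : S.Exact) :
    ((S.map (extendScalars.{0, 0, 0} f)).map
      ((MonoidalCategory.tensoringLeft (ModuleCat.{0} R)).obj X)).Exact := by
  rw [ShortComplex.ShortExact.moduleCat_exact_iff_function_exact] at hS ⊢
  let := f.toAlgebra
  let : Module B X := Module.compHom X f
  have : IsScalarTower B R X := ⟨fun b r x => by
    rw [Algebra.smul_def, mul_smul]; rfl⟩
  have : Module.Flat B X := hX
  have h := Module.Flat.lTensor_exact X hS
  refine (Function.Exact.iff_of_ladder_addEquiv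
    (f₁₂ := (LinearMap.lTensor X S.f.hom).toAddMonoidHom)
    (f₂₃ := (LinearMap.lTensor X S.g.hom).toAddMonoidHom)
    (g₁₂ := (LinearMap.lTensor X (LinearMap.baseChange R S.f.hom)).toAddMonoidHom)
    (g₂₃ := (LinearMap.lTensor X (LinearMap.baseChange R S.g.hom)).toAddMonoidHom)
    (TensorProduct.AlgebraTensorModule.cancelBaseChange B R R X S.X₁).symm.toAddEquiv
    (TensorProduct.AlgebraTensorModule.cancelBaseChange B R R X S.X₂).symm.toAddEquiv
    (TensorProduct.AlgebraTensorModule.cancelBaseChange B R R X S.X₃).symm.toAddEquiv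
    ?_ ?_).2 h
  · ext x
    induction x using TensorProduct.induction_on with
    | zero => simp
    | tmul x y => rfl
    | add x y hx hy => rw [map_add, hx, hy, map_add]
  · ext x
    induction x using TensorProduct.induction_on with
    | zero => simp
    | tmul x y => rfl
    | add x y hx hy => rw [map_add, hx, hy, map_add]

/-- If `R` and `X` are flat over `B`, then `X` is `Tor`-independent over `R` of any module
extended from `B`. -/
theorem isZero_Tor_extendScalars (f : B →+* R) (hf : f.Flat) (X : ModuleCat.{0} R)
    (hX : Module.Flat B ((restrictScalars f).obj X)) (N : ModuleCat.{0} B) (n : ℕ) :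
    Limits.IsZero (((Tor (ModuleCat.{0} R) (n + 1)).obj X).obj
      ((extendScalars.{0, 0, 0} f).obj N)) := by
  have := preservesFiniteLimits_extendScalars_of_flat hf
  have : (extendScalars.{0, 0, 0} f).PreservesHomology :=
    Functor.preservesHomology_of_preservesEpis_and_kernels _
  let P := ProjectiveResolution.of N
  let Q := (extendScalars.{0, 0, 0} f).mapProjectiveResolution P
  refine Limits.IsZero.of_iso ?_
    (Q.isoLeftDerivedObj ((MonoidalCategory.tensoringLeft (ModuleCat.{0} R)).obj X) (n + 1))
  have h : (P.complex.sc (n + 1)).Exact := P.complex_exactAt_succ n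
  have hF := exact_map_extendScalars_comp_tensorLeft f X hX _ h
  have : HomologicalComplex.ExactAt
      ((((MonoidalCategory.tensoringLeft (ModuleCat.{0} R)).obj X).mapHomologicalComplex _).obj
        (((extendScalars.{0, 0, 0} f).mapHomologicalComplex _).obj P.complex)) (n + 1) :=
    hF
  exact this.isZero_homology

variable {N S : Type} [CommRing N] [CommRing S]

theorem nonempty_extendScalars_iso_of_isPushout {f : B →+* R} {g : B →+* N} {s : R →+* S}
    {t : N →+* S} (h : IsPushout (CommRingCat.ofHom f) (CommRingCat.ofHom g)
      (CommRingCat.ofHom s) (CommRingCat.ofHom t)) :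
    Nonempty ((extendScalars.{0, 0, 0} f).obj ((restrictScalars g).obj (of N N)) ≅
      (restrictScalars s).obj (of S S)) := by
  have hw : s.comp f = t.comp g := congrArg CommRingCat.Hom.hom h.w
  algebraize [f, g, s, t, s.comp f]
  have : IsScalarTower B N S := .of_algebraMap_eq' hw
  have hp : Algebra.IsPushout B R N S := CommRingCat.isPushout_iff_isPushout.1 h
  exact ⟨(hp.out.equiv).toModuleIso⟩

/-- Base change for `Tor`: if `S` is the pushout of `R ← B → N`, `B → R` is flat and
`p : R → S` makes `S` a flat `B`-module, then `S` via `p` and `S` via the pushout map are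
`Tor`-independent over `R`. -/
theorem isZero_Tor_restrictScalars_of_isPushout {f : B →+* R} {g : B →+* N} {s : R →+* S}
    {t : N →+* S} (h : IsPushout (CommRingCat.ofHom f) (CommRingCat.ofHom g)
      (CommRingCat.ofHom s) (CommRingCat.ofHom t)) (hf : f.Flat) (p : R →+* S)
    (hp : (p.comp f).Flat) (n : ℕ) :
    Limits.IsZero (((Tor (ModuleCat.{0} R) (n + 1)).obj
      ((restrictScalars p).obj (of S S))).obj ((restrictScalars s).obj (of S S))) := by
  obtain ⟨e⟩ := nonempty_extendScalars_iso_of_isPushout h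
  refine Limits.IsZero.of_iso ?_
    (((Tor (ModuleCat.{0} R) (n + 1)).obj ((restrictScalars p).obj (of S S))).mapIso e.symm)
  have hp' : Module.Flat B ((restrictScalars f).obj ((restrictScalars p).obj (of S S))) := hp
  exact isZero_Tor_extendScalars f hf _ hp' _ n

end ModuleCat

namespace MvPolynomial

variable {k ι : Type} [CommRing k]

theorem flat_rename_subtypeVal (P : ι → Prop) :
    (rename (Subtype.val : {i // P i} → ι) : MvPolynomial _ k →ₐ[k] _).toRingHom.Flat := by
  classical
  let e : MvPolynomial {i // ¬ P i} (MvPolynomial {i // P i} k) ≃ₐ[k] MvPolynomial ι k :=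
    (sumAlgEquiv k {i // ¬ P i} {i // P i}).symm.trans
      (renameEquiv k ((Equiv.sumComm _ _).trans (Equiv.sumCompl P)))
  have h : (rename (Subtype.val : {i // P i} → ι) : MvPolynomial _ k →ₐ[k] _).toRingHom =
      e.toRingEquiv.toRingHom.comp
        (algebraMap (MvPolynomial {i // P i} k) (MvPolynomial {i // ¬ P i} _)) := by
    ext i <;> simp [e, algebraMap_eq]
  rw [h]
  exact .comp (RingHom.flat_algebraMap_iff.2 inferInstance) (.of_bijective e.bijective)

/-- The homomorphism `R → R[u]` scaling the variable `X i` by `u ^ a i`. -/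
noncomputable def scaleVars (a : ι → ℕ) :
    MvPolynomial ι k →ₐ[k] Polynomial (MvPolynomial ι k) :=
  aeval fun i => Polynomial.C (X i) * Polynomial.X ^ a i

@[simp]
theorem scaleVars_X (a : ι → ℕ) (i : ι) : scaleVars (k := k) a (X i) =
    Polynomial.C (X i) * Polynomial.X ^ a i := by
  simp [scaleVars]

@[simp]
theorem scaleVars_C (a : ι → ℕ) (c : k) : scaleVars a (C c : MvPolynomial ι k) =
    Polynomial.C (C c) :=
  (scaleVars a).commutes c

theorem flat_scaleVars_comp_rename {P : ι → Prop} {a : ι → ℕ} (ha : ∀ i, P i → a i = 0) :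
    ((scaleVars a : MvPolynomial ι k →ₐ[k] _).toRingHom.comp
      (rename (Subtype.val : {i // P i} → ι)).toRingHom).Flat := by
  have h : (scaleVars a : MvPolynomial ι k →ₐ[k] _).toRingHom.comp
      (rename (Subtype.val : {i // P i} → ι)).toRingHom =
      (algebraMap (MvPolynomial ι k) (Polynomial (MvPolynomial ι k))).comp
        (rename (Subtype.val : {i // P i} → ι) : MvPolynomial _ k →ₐ[k] _).toRingHom := by
    refine ringHom_ext (by simp) fun i => ?_
    simp [ha i i.2]
  rw [h]
  exact (flat_rename_subtypeVal P).comp (RingHom.flat_algebraMap_iff.2 inferInstance)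

theorem isPushout_scaleVars {P : ι → Prop} {b : ι → ℕ} (hb : ∀ i, ¬ P i → b i = 0) :
    IsPushout
      (CommRingCat.ofHom (rename (R := k) (Subtype.val : {i // P i} → ι)).toRingHom)
      (CommRingCat.ofHom (scaleVars (k := k) fun i : {i // P i} => b i).toRingHom)
      (CommRingCat.ofHom (scaleVars (k := k) b).toRingHom)
      (CommRingCat.ofHom (Polynomial.mapRingHom
        (rename (R := k) (Subtype.val : {i // P i} → ι)).toRingHom)) := by
  classical
  refine ⟨⟨?_⟩, ⟨Limits.PushoutCocone.IsColimit.mk _ (fun c => CommRingCat.ofHom <|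
    Polynomial.eval₂RingHom (eval₂Hom (c.inl.hom.comp C)
      fun i => if h : P i then c.inr.hom (Polynomial.C (X ⟨i, h⟩)) else c.inl.hom (X i))
      (c.inr.hom Polynomial.X)) ?_ ?_ ?_⟩⟩
  · ext : 1
    refine ringHom_ext (by simp) fun i => ?_
    simp
  · intro c
    have hc := congrArg CommRingCat.Hom.hom c.condition
    ext : 1
    refine ringHom_ext (by simp) fun i => ?_
    by_cases h : P i
    · have := congr($hc (X ⟨i, h⟩))
      simp at this
      simp [h, this]
    · simp [h, hb i h]
  · intro c
    have hc := congrArg CommRingCat.Hom.hom c.condition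
    ext : 1
    refine Polynomial.ringHom_ext' (ringHom_ext (fun r => ?_) fun i => ?_) (by simp)
    · have := congr($hc (C r))
      simp at this
      simp [this]
    · simp [i.2]
  · intro c m hm₁ hm₂
    have h₁ := congrArg CommRingCat.Hom.hom hm₁
    have h₂ := congrArg CommRingCat.Hom.hom hm₂
    ext : 1
    refine Polynomial.ringHom_ext' (ringHom_ext (fun r => ?_) fun i => ?_) ?_
    · have := congr($h₁ (C r))
      simpa using this
    · by_cases h : P i
      · have := congr($h₂ (Polynomial.C (X ⟨i, h⟩)))
        simpa [h] using this
      · have := congr($h₁ (X i))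
        simpa [h, hb i h] using this
    · have := congr($h₂ Polynomial.X)
      simpa using this

end MvPolynomial

namespace MvPolynomial

variable {k ι : Type} [CommRing k]

/-- The homomorphism `R → R[u, u⁻¹]` scaling the variable `X i` by `u ^ v i`. -/
noncomputable def laurentScaleVars (v : ι → ℤ) :
    MvPolynomial ι k →ₐ[k] LaurentPolynomial (MvPolynomial ι k) :=
  aeval fun i => LaurentPolynomial.C (X i) * T (v i)

@[simp]
theorem laurentScaleVars_X (v : ι → ℤ) (i : ι) :
    laurentScaleVars (k := k) v (X i) = LaurentPolynomial.C (X i) * T (v i) := by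
  simp [laurentScaleVars]

@[simp]
theorem laurentScaleVars_C (v : ι → ℤ) (c : k) :
    laurentScaleVars v (C c : MvPolynomial ι k) = LaurentPolynomial.C (C c) :=
  (laurentScaleVars v).commutes c

/-- The homomorphism `R[u] → R[u, u⁻¹]` over `u` scaling the variable `X i` by `u ^ v i`. -/
noncomputable def polynomialLaurentScaleVars (v : ι → ℤ) :
    Polynomial (MvPolynomial ι k) →ₐ[k] LaurentPolynomial (MvPolynomial ι k) :=
  Polynomial.eval₂AlgHom (laurentScaleVars v) (T 1) fun _ => Commute.all _ _

@[simp]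
theorem polynomialLaurentScaleVars_C (v : ι → ℤ) (r : MvPolynomial ι k) :
    polynomialLaurentScaleVars v (Polynomial.C r) = laurentScaleVars v r := by
  simp [polynomialLaurentScaleVars]

@[simp]
theorem polynomialLaurentScaleVars_X (v : ι → ℤ) :
    polynomialLaurentScaleVars (k := k) v Polynomial.X = T 1 := by
  simp [polynomialLaurentScaleVars]

theorem polynomialLaurentScaleVars_scaleVars (v : ι → ℤ) (a : ι → ℕ) (r : MvPolynomial ι k) :
    polynomialLaurentScaleVars v (scaleVars a r) = laurentScaleVars (fun i => v i + a i) r := by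
  have h : (polynomialLaurentScaleVars v).comp (scaleVars a) =
      laurentScaleVars (k := k) fun i => v i + a i := by
    ext1 i
    simp only [AlgHom.comp_apply, scaleVars_X, map_mul, map_pow, polynomialLaurentScaleVars_C,
      polynomialLaurentScaleVars_X, laurentScaleVars_X, T_pow, T_add, mul_one, mul_assoc]
  exact DFunLike.congr_fun h r

theorem polynomialLaurentScaleVars_injective (v : ι → ℤ) :
    Function.Injective (polynomialLaurentScaleVars (k := k) v) := by
  let u : (LaurentPolynomial (MvPolynomial ι k))ˣ :=
    ⟨T 1, T (-1), by rw [← T_add]; rfl, by rw [← T_add]; rfl⟩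
  have hu (n : ℤ) : (u ^ n).val = T n := by
    induction n with
    | zero => simp
    | succ n ih => rw [zpow_add_one, Units.val_mul, ih, T_add]
    | pred n ih => rw [zpow_sub_one, Units.val_mul, ih, T_sub]; rfl
  let τ := LaurentPolynomial.eval₂ (laurentScaleVars (k := k) (-v)).toRingHom u
  have h : τ.comp (polynomialLaurentScaleVars v).toRingHom = Polynomial.toLaurent := by
    refine Polynomial.ringHom_ext' (ringHom_ext (fun r => ?_) fun i => ?_) ?_
    · simp [τ]
    · simp [τ, hu, mul_assoc, ← T_add, - T_mul]
    · simp [τ, u]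
  refine Function.Injective.of_comp (f := τ) ?_
  have := Polynomial.toLaurent_injective (R := MvPolynomial ι k)
  rwa [← h] at this

variable {w : ι → ℤ} {σ : MvPolynomial ι k →ₐ[k] LaurentPolynomial (MvPolynomial ι k)}

theorem eq_laurentScaleVars
    (hσ : ∀ (i : ℤ) (r : MvPolynomial ι k), r ∈ weightedHomogeneousSubmodule k w i →
      σ r = LaurentPolynomial.C r * T i) : σ = laurentScaleVars w := by
  ext1 i
  rw [hσ (w i) (X i) (isWeightedHomogeneous_X k w i), laurentScaleVars_X]

theorem laurentScaleVars_zero (r : MvPolynomial ι k) :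
    laurentScaleVars (fun _ => 0) r = LaurentPolynomial.C r := by
  have h : (laurentScaleVars (k := k) fun _ : ι => 0).toRingHom = LaurentPolynomial.C :=
    ringHom_ext (by simp) (by simp)
  exact DFunLike.congr_fun h r

theorem polynomialLaurentScaleVars_scaleVars_toNat_neg (w : ι → ℤ) (r : MvPolynomial ι k) :
    polynomialLaurentScaleVars (fun i => min (w i) 0) (scaleVars (fun i => (-w i).toNat) r) =
      LaurentPolynomial.C r := by
  rw [polynomialLaurentScaleVars_scaleVars, ← laurentScaleVars_zero]
  congr! 3
  grind

theorem polynomialLaurentScaleVars_scaleVars_toNat (w : ι → ℤ) (r : MvPolynomial ι k) :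
    polynomialLaurentScaleVars (fun i => min (w i) 0) (scaleVars (fun i => (w i).toNat) r) =
      laurentScaleVars w r := by
  rw [polynomialLaurentScaleVars_scaleVars]
  congr! 3
  grind

theorem range_polynomialLaurentScaleVars (w : ι → ℤ) :
    (polynomialLaurentScaleVars (k := k) fun i => min (w i) 0).range =
      Qsub (laurentScaleVars w) := by
  apply le_antisymm
  · have hC (r : MvPolynomial ι k) : LaurentPolynomial.C r ∈ Qsub (laurentScaleVars w) :=
      Algebra.subset_adjoin (.inl (.inl ⟨r, rfl⟩))
    have hs (r : MvPolynomial ι k) : laurentScaleVars w r ∈ Qsub (laurentScaleVars w) :=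
      Algebra.subset_adjoin (.inl (.inr ⟨r, rfl⟩))
    have hT : T 1 ∈ Qsub (laurentScaleVars (k := k) w) := Algebra.subset_adjoin (.inr rfl)
    have hv : (laurentScaleVars (k := k) fun i => min (w i) 0).range ≤
        Qsub (laurentScaleVars w) := by
      rw [laurentScaleVars, aeval_range, Algebra.adjoin_le_iff]
      rintro _ ⟨i, rfl⟩
      rcases le_total (w i) 0 with h | h
      · simpa [h] using hs (X i)
      · simpa [h] using hC (X i)
    rintro _ ⟨q, rfl⟩
    induction q using Polynomial.induction_on' with
    | add p q hp hq =>
      simp only [AlgHom.toRingHom_eq_coe, RingHom.coe_coe, map_add] at hp hq ⊢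
      exact add_mem hp hq
    | monomial n r =>
      rw [← Polynomial.C_mul_X_pow_eq_monomial]
      simp only [AlgHom.toRingHom_eq_coe, RingHom.coe_coe, map_mul, map_pow,
        polynomialLaurentScaleVars_C, polynomialLaurentScaleVars_X]
      exact mul_mem (hv ⟨r, rfl⟩) (pow_mem hT n)
  · refine Algebra.adjoin_le ?_
    rintro _ ((⟨r, rfl⟩ | ⟨r, rfl⟩) | rfl)
    · exact ⟨_, polynomialLaurentScaleVars_scaleVars_toNat_neg w r⟩
    · exact ⟨_, polynomialLaurentScaleVars_scaleVars_toNat w r⟩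
    · exact ⟨_, polynomialLaurentScaleVars_X _⟩

end MvPolynomial

/-- For `R = k[Xᵢ : i ∈ ι]` a polynomial ring graded by a weight function
`w : ι → ℤ`, the higher Tor's of `Q(R)` with itself, with module structures given by
`p = π` (the inclusion of constants) and by `s = σ` respectively, vanish:
`Tor_i^R(Q(R)_p, Q(R)_s) = 0` for all `i > 0`. -/
theorem stmt9 {k : Type} [CommRing k] {ι : Type} [Finite ι] (w : ι → ℤ)
    (σ : MvPolynomial ι k →ₐ[k] LaurentPolynomial (MvPolynomial ι k))
    (hσ : ∀ (i : ℤ) (r : MvPolynomial ι k),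
      r ∈ MvPolynomial.weightedHomogeneousSubmodule k w i →
      σ r = LaurentPolynomial.C r * LaurentPolynomial.T i)
    (hσmem : ∀ x : MvPolynomial ι k, σ x ∈ Qsub σ)
    (hCmem : ∀ x : MvPolynomial ι k,
      (LaurentPolynomial.C x : LaurentPolynomial (MvPolynomial ι k)) ∈ Qsub σ)
    (i : ℕ) (hi : 0 < i) :
    Limits.IsZero
      (((Tor (ModuleCat (MvPolynomial ι k)) i).obj
          ((ModuleCat.restrictScalars
              (RingHom.codRestrict LaurentPolynomial.C (Qsub σ) hCmem)).obj
            (ModuleCat.of ↥(Qsub σ) ↥(Qsub σ)))).obj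
        ((ModuleCat.restrictScalars
            (RingHom.codRestrict σ.toRingHom (Qsub σ) hσmem)).obj
          (ModuleCat.of ↥(Qsub σ) ↥(Qsub σ)))) := by
  obtain ⟨n, rfl⟩ := Nat.exists_eq_add_one.2 hi
  obtain rfl := MvPolynomial.eq_laurentScaleVars hσ
  -- `Q(R)` is a polynomial ring over `R`, in which `p` and `s` scale disjoint sets of variables.
  let e : Polynomial (MvPolynomial ι k) ≃ₐ[k] Qsub (MvPolynomial.laurentScaleVars (k := k) w) :=
    (AlgEquiv.ofInjective _ (MvPolynomial.polynomialLaurentScaleVars_injective _)).trans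
      (Subalgebra.equivOfEq _ _ (MvPolynomial.range_polynomialLaurentScaleVars w))
  have hp : RingHom.codRestrict LaurentPolynomial.C (Qsub _) hCmem =
      e.toRingEquiv.toRingHom.comp (MvPolynomial.scaleVars fun i => (-w i).toNat).toRingHom :=
    RingHom.ext fun r => Subtype.ext (MvPolynomial.polynomialLaurentScaleVars_scaleVars_toNat_neg w r).symm
  have hs : RingHom.codRestrict (MvPolynomial.laurentScaleVars w).toRingHom (Qsub _) hσmem =
      e.toRingEquiv.toRingHom.comp (MvPolynomial.scaleVars fun i => (w i).toNat).toRingHom :=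
    RingHom.ext fun r => Subtype.ext (MvPolynomial.polynomialLaurentScaleVars_scaleVars_toNat w r).symm
  have hpo := (MvPolynomial.isPushout_scaleVars (k := k) (P := fun i => 0 ≤ w i)
      (b := fun i => (w i).toNat) (by grind)).of_iso (Iso.refl _) (Iso.refl _) (Iso.refl _)
      e.toRingEquiv.toCommRingCatIso (inl' := CommRingCat.ofHom (RingHom.codRestrict
        (MvPolynomial.laurentScaleVars w).toRingHom (Qsub _) hσmem))
      ((Category.comp_id _).trans (Category.id_comp _).symm)
      ((Category.comp_id _).trans (Category.id_comp _).symm) (by rw [hs]; rfl) (Category.id_comp _).symm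
  refine ModuleCat.isZero_Tor_restrictScalars_of_isPushout hpo
    (MvPolynomial.flat_rename_subtypeVal _) _ ?_ n
  rw [hp, RingHom.comp_assoc]
  exact (MvPolynomial.flat_scaleVars_comp_rename (by grind)).comp (.of_bijective e.bijective)
end

section
/- Let f : R → S be a homomorphism of ℤ-graded commutative k-algebras preserving the gradings (f(𝒜 i) ⊆ ℬ i for all i), and assume: (1) S is flat as an R-module via f, and (2) S is generated as an R-module by its degree-zero part ℬ 0 (i.e. every element of S is an R-linear combination, via f, of degree-zero elements). Let F : Q(R) → Q(S) be the restriction of the k-algebra homomorphism R[u,u⁻¹] → S[u,u⁻¹] obtained by applying f coefficientwise. Then the k-algebra homomorphism Q(R) ⊗_R S → Q(S), q ⊗ t ↦ F(q)·π_S(t), is bijective, where the tensor product is taken with R acting on Q(R) through p = π (the inclusion of constants) and on S through f. -/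
open LaurentPolynomial

open scoped TensorProduct

set_option synthInstance.maxHeartbeats 1000000
set_option maxHeartbeats 1000000

/-- If `S` is flat over `R` and `M` maps injectively into `R[T;T⁻¹]`, then `M ⊗[R] S` embeds into
the finitely supported functions `ℤ →₀ S`. -/
theorem injective_finsuppScalarLeft_comp_rTensor {R S M : Type*} [CommRing R] [AddCommGroup S]
    [Module R S] [Module.Flat R S] [AddCommGroup M] [Module R M]
    (ι : M →ₗ[R] R[T;T⁻¹]) (hι : Function.Injective ι) :
    Function.Injective fun z : M ⊗[R] S => TensorProduct.finsuppScalarLeft R S ℤ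
      (((AddMonoidAlgebra.coeffLinearEquiv R).toLinearMap ∘ₗ ι).rTensor S z) := by
  refine (TensorProduct.finsuppScalarLeft R S ℤ).injective.comp ?_
  exact Module.Flat.rTensor_preserves_injective_linearMap _
    ((AddMonoidAlgebra.coeffLinearEquiv R).injective.comp hι)

/-- A map of Laurent polynomial rings given by `f` on coefficients acts coefficientwise. -/
theorem coeff_map_mul_C {R S F : Type*} [CommRing R] [CommRing S]
    [FunLike F R[T;T⁻¹] S[T;T⁻¹]] [AddMonoidHomClass F R[T;T⁻¹] S[T;T⁻¹]]
    (f : R →+* S) (Ψ : F)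
    (hΨ : ∀ (x : R) (n : ℤ), Ψ (C x * T n) = C (f x) * T n)
    (p : R[T;T⁻¹]) (t : S) (n : ℤ) :
    (Ψ p * C t).coeff n = f (p.coeff n) * t := by
  induction p using LaurentPolynomial.induction_on' with
  | add p q hp hq => simp [add_mul, hp, hq]
  | C_mul_T m x =>
    rw [hΨ, mul_right_comm, ← map_mul, ← single_eq_C_mul_T, ← single_eq_C_mul_T,
      AddMonoidAlgebra.coeff_single, AddMonoidAlgebra.coeff_single]
    by_cases h : m = n <;> simp [h]

/-- A graded homomorphism is compatible with the coactions. -/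
theorem coaction_comp {k R S : Type*} [CommRing k] [CommRing R] [CommRing S]
    [Algebra k R] [Algebra k S]
    (𝒜 : ℤ → Submodule k R) [GradedAlgebra 𝒜] (ℬ : ℤ → Submodule k S)
    (σR : R →ₐ[k] R[T;T⁻¹]) (hσR : ∀ (i : ℤ) (r : R), r ∈ 𝒜 i → σR r = C r * T i)
    (σS : S →ₐ[k] S[T;T⁻¹]) (hσS : ∀ (i : ℤ) (s : S), s ∈ ℬ i → σS s = C s * T i)
    (f : R →ₐ[k] S) (hf : ∀ (i : ℤ) (x : R), x ∈ 𝒜 i → f x ∈ ℬ i)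
    (Ψ : R[T;T⁻¹] →ₐ[k] S[T;T⁻¹])
    (hΨ : ∀ (x : R) (n : ℤ), Ψ (C x * T n) = C (f x) * T n) (r : R) :
    σS (f r) = Ψ (σR r) := by
  refine DirectSum.Decomposition.inductionOn 𝒜 (by simp) (fun {i} x => ?_) (fun x y hx hy => ?_) r
  · rw [hσR i x x.2, hΨ, hσS i _ (hf i x x.2)]
  · simp only [map_add, hx, hy]

/-- Let `f : R → S` be a graded homomorphism such that `S` is flat over `R`
via `f` and `S` is generated as an `R`-module by its degree-zero part.  Then the map
`Q(R) ⊗_R S → Q(S)`, `q ⊗ t ↦ F(q)·π_S(t)` (where `F : Q(R) → Q(S)` is the restriction of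
the coefficientwise extension `Ψ` of `f`, and `R` acts on `Q(R)` through `p = π`) is
bijective. -/
theorem stmt10 {k R S : Type*} [CommRing k] [CommRing R] [CommRing S]
    [Algebra k R] [Algebra k S]
    (𝒜 : ℤ → Submodule k R) [GradedAlgebra 𝒜]
    (ℬ : ℤ → Submodule k S) [GradedAlgebra ℬ]
    (σR : R →ₐ[k] LaurentPolynomial R)
    (hσR : ∀ (i : ℤ) (r : R), r ∈ 𝒜 i →
      σR r = LaurentPolynomial.C r * LaurentPolynomial.T i)
    (σS : S →ₐ[k] LaurentPolynomial S)
    (hσS : ∀ (i : ℤ) (s : S), s ∈ ℬ i →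
      σS s = LaurentPolynomial.C s * LaurentPolynomial.T i)
    (f : R →ₐ[k] S)
    (hfgr : ∀ (i : ℤ) (x : R), x ∈ 𝒜 i → f x ∈ ℬ i)
    -- `S` as an `R`-algebra via `f`
    [instRS : Algebra R S] (hRS : algebraMap R S = f.toRingHom)
    -- hypothesis (1): `S` is flat as an `R`-module via `f`
    (hflat : Module.Flat R S)
    -- hypothesis (2): `S` is generated as an `R`-module by its degree-zero part `ℬ 0`
    (hgen : Submodule.span R (ℬ 0 : Set S) = ⊤)
    -- `Q(R)` as an `R`-algebra via `p = π` (the inclusion of constants)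
    [instRQ : Algebra R ↥(Qsub σR)] (hRQ : ∀ x : R,
      ((algebraMap R ↥(Qsub σR)) x : LaurentPolynomial R) = LaurentPolynomial.C x)
    -- the coefficientwise extension of `f` to Laurent polynomials
    (Ψ : LaurentPolynomial R →ₐ[k] LaurentPolynomial S)
    (hΨ : ∀ (x : R) (n : ℤ), Ψ (LaurentPolynomial.C x * LaurentPolynomial.T n) =
      LaurentPolynomial.C (f x) * LaurentPolynomial.T n)
    -- the map `q ⊗ t ↦ F(q)·π_S(t)`
    (Θ : (↥(Qsub σR) ⊗[R] S) →+* ↥(Qsub σS))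
    (hΘ : ∀ (q : ↥(Qsub σR)) (t : S),
      ((Θ (q ⊗ₜ[R] t) : ↥(Qsub σS)) : LaurentPolynomial S) =
        Ψ (q : LaurentPolynomial R) * LaurentPolynomial.C t) :
    Function.Bijective Θ := by
  have hsmul : ∀ (r : R) (t : S), r • t = f r * t := fun r t => by
    rw [Algebra.smul_def, hRS]; rfl
  constructor
  · let ι : ↥(Qsub σR) →ₗ[R] R[T;T⁻¹] :=
      { toFun := fun q => (q : R[T;T⁻¹])
        map_add' := fun _ _ => rfl
        map_smul' := fun r q => by
          rw [Algebra.smul_def, RingHom.id_apply, smul_eq_C_mul, ← hRQ]; rfl }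
    have key : ∀ (z : ↥(Qsub σR) ⊗[R] S) (n : ℤ),
        (Θ z : S[T;T⁻¹]).coeff n = TensorProduct.finsuppScalarLeft R S ℤ
          (((AddMonoidAlgebra.coeffLinearEquiv R).toLinearMap ∘ₗ ι).rTensor S z) n := by
      intro z n
      induction z using TensorProduct.induction_on with
      | zero => simp
      | tmul q t =>
        rw [hΘ, coeff_map_mul_C f.toRingHom Ψ hΨ, LinearMap.rTensor_tmul,
          TensorProduct.finsuppScalarLeft_apply_tmul_apply, hsmul]
        rfl
      | add x y hx hy => simp [hx, hy]
    intro x y hxy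
    refine injective_finsuppScalarLeft_comp_rTensor ι Subtype.val_injective ?_
    ext n
    rw [← key, ← key, hxy]
  · have hΨC : ∀ x : R, Ψ (C x) = C (f x) := fun x => by simpa using hΨ x 0
    have hΨT : ∀ n : ℤ, Ψ (T n) = T n := fun n => by simpa using hΨ 1 n
    let P : Subsemiring S[T;T⁻¹] := ((Qsub σS).val.toRingHom.comp Θ).rangeS
    have hP : ∀ (q : R[T;T⁻¹]) (_ : q ∈ Qsub σR) (t : S), Ψ q * C t ∈ P :=
      fun q hq t => ⟨⟨q, hq⟩ ⊗ₜ[R] t, hΘ ⟨q, hq⟩ t⟩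
    have hC : ∀ t : S, C t ∈ P := fun t => by
      simpa using hP 1 (one_mem _) t
    have hσ : ∀ s : S, σS s ∈ P := by
      intro s
      have hs : s ∈ Submodule.span R (ℬ 0 : Set S) := hgen ▸ Submodule.mem_top
      induction hs using Submodule.span_induction with
      | mem s hs => simpa [hσS 0 s hs] using hC s
      | zero => simp [zero_mem]
      | add x y _ _ hx hy => rw [map_add]; exact add_mem hx hy
      | smul r x _ hx =>
        rw [hsmul, map_mul, coaction_comp 𝒜 ℬ σR hσR σS hσS f hfgr Ψ hΨ]
        refine mul_mem ?_ hx
        simpa using hP (σR r) (Algebra.subset_adjoin (Or.inl (Or.inr ⟨r, rfl⟩))) 1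
    have hT : (T 1 : S[T;T⁻¹]) ∈ P := by
      simpa [hΨT] using hP (T 1) (Algebra.subset_adjoin (Or.inr rfl)) 1
    have hle : ∀ x ∈ Qsub σS, x ∈ P := by
      intro x hx
      induction hx using Algebra.adjoin_induction with
      | mem x hx =>
        rcases hx with (⟨s, rfl⟩ | ⟨s, rfl⟩) | rfl
        exacts [hC s, hσ s, hT]
      | algebraMap c => exact hC (algebraMap k S c)
      | add x y _ _ hx hy => exact add_mem hx hy
      | mul x y _ _ hx hy => exact mul_mem hx hy
    intro y
    obtain ⟨z, hz⟩ := hle y y.2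
    exact ⟨z, Subtype.ext hz⟩
end

section
/- Let n ≥ 1 and let R = k[x_1,…,x_n,y_1,…,y_n] be a polynomial ring graded so that each x_i has degree 1 and each y_j has degree −1, and let R_0 denote its degree-zero subalgebra. Let φ : R ⊗_{R_0} R → Q(R) be the k-algebra homomorphism determined by φ(a ⊗ b) = π(a)·σ(b) (this is well defined over R_0 since π and σ agree on degree-zero elements). Then for every pair of indices i, j, the map induced by φ between the localization of R ⊗_{R_0} R away from the element x_i ⊗ y_j and the localization of Q(R) away from φ(x_i ⊗ y_j) = π(x_i)·σ(y_j) is bijective. -/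
open LaurentPolynomial

open scoped TensorProduct

set_option synthInstance.maxHeartbeats 1000000
set_option maxHeartbeats 1000000

/-- The subring of elements carried into `S` by some power of `s ∈ S`. -/
def Subring.powSaturation {B : Type*} [CommRing B] (S : Subring B) (s : B) (hs : s ∈ S) :
    Subring B where
  carrier := {t | ∃ N : ℕ, s ^ N * t ∈ S}
  mul_mem' := by
    rintro a b ⟨N, hN⟩ ⟨M, hM⟩
    refine ⟨N + M, ?_⟩
    have := S.mul_mem hN hM
    rwa [show s ^ (N + M) * (a * b) = s ^ N * a * (s ^ M * b) by ring]
  one_mem' := ⟨0, by simp⟩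
  add_mem' := by
    rintro a b ⟨N, hN⟩ ⟨M, hM⟩
    refine ⟨N + M, ?_⟩
    rw [show s ^ (N + M) * (a + b) = s ^ M * (s ^ N * a) + s ^ N * (s ^ M * b) by ring]
    exact S.add_mem (S.mul_mem (S.pow_mem hs M) hN) (S.mul_mem (S.pow_mem hs N) hM)
  zero_mem' := ⟨0, by simp⟩
  neg_mem' := by
    rintro a ⟨N, hN⟩
    exact ⟨N, by simpa using S.neg_mem hN⟩

theorem Subring.mem_powSaturation {B : Type*} [CommRing B] {S : Subring B} {s : B} {hs : s ∈ S}
    {t : B} : t ∈ S.powSaturation s hs ↔ ∃ N : ℕ, s ^ N * t ∈ S :=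
  Iff.rfl

theorem Subring.le_powSaturation {B : Type*} [CommRing B] (S : Subring B) (s : B) (hs : s ∈ S) :
    S ≤ S.powSaturation s hs :=
  fun t ht => ⟨0, by simpa using ht⟩

/-- The map of localizations away from `s` induced by `f` is bijective if the kernel of `f` is
`s`-torsion and the cokernel is `f s`-torsion. -/
theorem bijective_localizationAway_map {A B : Type*} [CommRing A] [CommRing B] (f : A →+* B)
    (s : A) (hinj : ∀ t, f t = 0 → ∃ N : ℕ, s ^ N * t = 0)
    (hsurj : ∀ b, ∃ N : ℕ, f s ^ N * b ∈ f.range)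
    (h : Submonoid.powers s ≤ (Submonoid.powers (f s)).comap f) :
    Function.Bijective (IsLocalization.map (S := Localization.Away s) (M := Submonoid.powers s)
      (T := Submonoid.powers (f s)) (Localization.Away (f s)) f h :
      Localization.Away s →+* Localization.Away (f s)) := by
  constructor
  · rw [injective_iff_map_eq_zero]
    intro z hz
    obtain ⟨a, m, rfl⟩ := IsLocalization.exists_mk'_eq (Submonoid.powers s) z
    rw [IsLocalization.map_mk', IsLocalization.mk'_eq_zero_iff] at hz
    obtain ⟨⟨_, M, rfl⟩, hM⟩ := hz
    obtain ⟨N, hN⟩ := hinj (s ^ M * a) (by simpa using hM)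
    rw [IsLocalization.mk'_eq_zero_iff]
    exact ⟨⟨s ^ (N + M), N + M, rfl⟩, by simpa [pow_add, mul_assoc] using hN⟩
  · intro z
    obtain ⟨b, ⟨_, M, rfl⟩, rfl⟩ := IsLocalization.exists_mk'_eq (Submonoid.powers (f s)) z
    obtain ⟨N, a, ha⟩ := hsurj b
    refine ⟨IsLocalization.mk' _ a (⟨s ^ (N + M), N + M, rfl⟩ : Submonoid.powers s), ?_⟩
    rw [IsLocalization.map_mk', IsLocalization.mk'_eq_iff_eq]
    simp only [map_pow, ha]
    congr 1
    ring

section FlopKernel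

open MvPolynomial (X)

variable {k ι : Type*} [CommRing k]

/-- The `k`-linear ring endomorphism of `k[x, y][u, u⁻¹]` with `x ↦ x`, `y ↦ y u`, `u ↦ u`. -/
noncomputable def twistRight :
    LaurentPolynomial (MvPolynomial (ι ⊕ ι) k) →+* LaurentPolynomial (MvPolynomial (ι ⊕ ι) k) :=
  LaurentPolynomial.eval₂
    (MvPolynomial.eval₂Hom (LaurentPolynomial.C.comp MvPolynomial.C)
      (Sum.elim (fun a => LaurentPolynomial.C (X (.inl a)))
        fun b => LaurentPolynomial.C (X (.inr b)) * T 1))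
    (LaurentPolynomial.isUnit_T 1).unit

theorem twistRight_T (m : ℤ) : twistRight (k := k) (ι := ι) (T m) = T m := by
  have h : ∀ m : ℕ, twistRight (k := k) (ι := ι) (T m) = T m := fun m => by
    simp [twistRight, LaurentPolynomial.T_pow]
  obtain ⟨m, rfl | rfl⟩ := m.eq_nat_or_neg
  · exact h m
  · have h₁ : twistRight (k := k) (ι := ι) (T (-m)) * T m = 1 := by
      rw [← h m, ← map_mul, ← LaurentPolynomial.T_add]
      simp
    calc twistRight (k := k) (ι := ι) (T (-m))
        = twistRight (T (-m)) * T m * T (-m) := by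
          rw [mul_assoc, ← LaurentPolynomial.T_add]; simp
      _ = T (-m) := by rw [h₁, one_mul]

theorem twistRight_C_C (c : k) :
    twistRight (ι := ι) (LaurentPolynomial.C (MvPolynomial.C c)) =
      LaurentPolynomial.C (MvPolynomial.C c) := by
  simp [twistRight]

theorem twistRight_C_X_inl (a : ι) :
    twistRight (k := k) (LaurentPolynomial.C (X (.inl a))) = LaurentPolynomial.C (X (.inl a)) := by
  simp [twistRight]

theorem twistRight_C_X_inr (b : ι) :
    twistRight (k := k) (LaurentPolynomial.C (X (.inr b))) =
      LaurentPolynomial.C (X (.inr b)) * T 1 := by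
  simp [twistRight]

theorem Polynomial.comp_C_mul_X_injective {A : Type*} [CommRing A] {r : A} (hr : IsRegular r) :
    Function.Injective fun p : Polynomial A => p.comp (Polynomial.C r * Polynomial.X) := by
  intro p q h
  ext m
  have := congrArg (fun p => Polynomial.coeff p m) h
  simp only [Polynomial.comp_C_mul_X_coeff] at this
  exact (hr.pow m).right this

/-- Let `A` be generated by two copies `l`, `r` of `k[x, y]` which agree on constants and on the
products `x_a y_b`. Then the kernel of a map `Φ` to `k[x, y][u, u⁻¹]` restricting to the constants
along `l` and to the coaction along `r` is torsion with respect to `l x_i * r y_j`. -/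
theorem exists_pow_mul_eq_zero_of_map_eq_zero {A : Type*} [CommRing A]
    (l r : MvPolynomial (ι ⊕ ι) k →+* A)
    (hgen : Subring.closure (Set.range l ∪ Set.range r) = ⊤)
    (hC : ∀ c, l (MvPolynomial.C c) = r (MvPolynomial.C c))
    (hXY : ∀ a b, l (X (.inl a) * X (.inr b)) = r (X (.inl a) * X (.inr b)))
    (Φ : A →+* LaurentPolynomial (MvPolynomial (ι ⊕ ι) k))
    (hl : ∀ p, Φ (l p) = LaurentPolynomial.C p)
    (hrx : ∀ a, Φ (r (X (.inl a))) = LaurentPolynomial.C (X (.inl a)) * T 1)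
    (hry : ∀ b, Φ (r (X (.inr b))) = LaurentPolynomial.C (X (.inr b)) * T (-1))
    (i j : ι) (t : A) (ht : Φ t = 0) :
    ∃ N : ℕ, (l (X (.inl i)) * r (X (.inr j))) ^ N * t = 0 := by
  let ψ₀ : MvPolynomial (ι ⊕ ι) k →+* A :=
    MvPolynomial.eval₂Hom (l.comp MvPolynomial.C)
      (Sum.elim (fun a => l (X (.inl a))) fun b => r (X (.inr b)))
  let ψ : Polynomial (MvPolynomial (ι ⊕ ι) k) →+* A :=
    Polynomial.eval₂RingHom ψ₀ (r (X (.inl i)))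
  have hψC : ∀ c, ψ (Polynomial.C (MvPolynomial.C c)) = l (MvPolynomial.C c) := by simp [ψ, ψ₀]
  have hψx : ∀ a, ψ (Polynomial.C (X (.inl a))) = l (X (.inl a)) := by simp [ψ, ψ₀]
  have hψy : ∀ b, ψ (Polynomial.C (X (.inr b))) = r (X (.inr b)) := by simp [ψ, ψ₀]
  have hψX : ψ Polynomial.X = r (X (.inl i)) := by simp [ψ]
  have hψ : Function.Injective (Φ.comp ψ) := by
    have key : twistRight.comp (Φ.comp ψ) = (Polynomial.toLaurent).comp
        (Polynomial.compRingHom (Polynomial.C (X (.inl i)) * Polynomial.X)) := by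
      ext x
      · simp [hψC, hl, twistRight_C_C]
      · rcases x with a | b
        · simp [hψx, hl, twistRight_C_X_inl]
        · simp [hψy, hry, twistRight_C_X_inr, twistRight_T]
      · simp [hψX, hrx, twistRight_C_X_inl, twistRight_T]
    refine Function.Injective.of_comp (f := twistRight) ?_
    rw [← RingHom.coe_comp, key]
    exact Polynomial.toLaurent_injective.comp
      (Polynomial.comp_C_mul_X_injective MvPolynomial.isRegular_X)
  set s := l (X (.inl i)) * r (X (.inr j)) with hs
  have hx : ∀ a, l (X (.inl a)) ∈ ψ.range := fun a => ⟨_, hψx a⟩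
  have hy : ∀ b, r (X (.inr b)) ∈ ψ.range := fun b => ⟨_, hψy b⟩
  have hx' : r (X (.inl i)) ∈ ψ.range := ⟨_, hψX⟩
  have hCmem : ∀ c, l (MvPolynomial.C c) ∈ ψ.range := fun c => ⟨_, hψC c⟩
  have hsmem : s ∈ ψ.range := mul_mem (hx i) (hy j)
  have hle := ψ.range.le_powSaturation s hsmem
  have htop : ψ.range.powSaturation s hsmem = ⊤ := by
    rw [eq_top_iff, ← hgen, Subring.closure_le]
    rintro _ (⟨p, rfl⟩ | ⟨p, rfl⟩)
    · induction p using MvPolynomial.induction_on with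
      | C c => exact hle (hCmem c)
      | add p q hp hq => rw [map_add]; exact add_mem hp hq
      | mul_X p x hp =>
        rw [map_mul]
        refine mul_mem hp ?_
        rcases x with a | b
        · exact hle (hx a)
        · refine ⟨1, ?_⟩
          rw [show s ^ 1 * l (X (.inr b)) = l (X (.inl i) * X (.inr b)) * r (X (.inr j)) by
            rw [hs, map_mul]; ring, hXY, map_mul]
          exact mul_mem (mul_mem hx' (hy b)) (hy j)
    · induction p using MvPolynomial.induction_on with
      | C c => rw [← hC]; exact hle (hCmem c)
      | add p q hp hq => rw [map_add]; exact add_mem hp hq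
      | mul_X p x hp =>
        rw [map_mul]
        refine mul_mem hp ?_
        rcases x with a | b
        · refine ⟨1, ?_⟩
          rw [show s ^ 1 * r (X (.inl a)) = l (X (.inl i)) * r (X (.inl a) * X (.inr j)) by
            rw [hs, map_mul]; ring, ← hXY, map_mul, mul_left_comm, ← map_mul, hXY, map_mul]
          exact mul_mem (hx a) (mul_mem hx' (hy j))
        · exact hle (hy b)
  obtain ⟨N, p, hp⟩ := Subring.mem_powSaturation.mp (htop ▸ Subring.mem_top t)
  refine ⟨N, ?_⟩
  have hp0 : p = 0 := hψ (by rw [RingHom.comp_apply, hp, map_mul, ht, mul_zero, map_zero])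
  rw [← hp, hp0, map_zero]

end FlopKernel

/-- For `R = k[x₁,…,xₙ,y₁,…,yₙ]` with `deg xᵢ = 1`, `deg yⱼ = −1`, and
`φ : R ⊗_{R₀} R → Q(R)` determined by `φ(a ⊗ b) = π(a)·σ(b)`, the map induced by `φ`
between the localizations away from `xᵢ ⊗ yⱼ` and away from `φ(xᵢ ⊗ yⱼ)` is bijective. -/
theorem stmt11 {k : Type*} [CommRing k] (n : ℕ) (hn : 1 ≤ n)
    (σ : MvPolynomial (Fin n ⊕ Fin n) k →ₐ[k]
      LaurentPolynomial (MvPolynomial (Fin n ⊕ Fin n) k))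
    (hσ : ∀ (i : ℤ) (r : MvPolynomial (Fin n ⊕ Fin n) k),
      r ∈ MvPolynomial.weightedHomogeneousSubmodule k
        (Sum.elim (fun _ : Fin n => (1 : ℤ)) fun _ : Fin n => (-1 : ℤ)) i →
      σ r = LaurentPolynomial.C r * LaurentPolynomial.T i)
    -- the degree-zero subalgebra `R₀`
    (R₀ : Subalgebra k (MvPolynomial (Fin n ⊕ Fin n) k))
    (hR₀ : (R₀ : Set (MvPolynomial (Fin n ⊕ Fin n) k)) =
      (MvPolynomial.weightedHomogeneousSubmodule k
        (Sum.elim (fun _ : Fin n => (1 : ℤ)) fun _ : Fin n => (-1 : ℤ)) 0 : Set _))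
    -- the map `φ : R ⊗_{R₀} R → Q(R)`, `a ⊗ b ↦ π(a)·σ(b)`
    (φ : (MvPolynomial (Fin n ⊕ Fin n) k ⊗[↥R₀] MvPolynomial (Fin n ⊕ Fin n) k) →+*
      ↥(Qsub σ))
    (hφ : ∀ a b : MvPolynomial (Fin n ⊕ Fin n) k,
      ((φ (a ⊗ₜ[↥R₀] b) : ↥(Qsub σ)) :
        LaurentPolynomial (MvPolynomial (Fin n ⊕ Fin n) k)) =
        LaurentPolynomial.C a * σ b)
    (i j : Fin n) :
    let ξ : MvPolynomial (Fin n ⊕ Fin n) k ⊗[↥R₀] MvPolynomial (Fin n ⊕ Fin n) k :=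
      (MvPolynomial.X (Sum.inl i)) ⊗ₜ[↥R₀] (MvPolynomial.X (Sum.inr j))
    Function.Bijective
      (IsLocalization.map
        (S := Localization.Away ξ)
        (M := Submonoid.powers ξ)
        (T := Submonoid.powers (φ ξ))
        (Localization.Away (φ ξ)) φ
        (Submonoid.powers_le.mpr (Submonoid.mem_comap.mpr (Submonoid.mem_powers _))) :
        Localization.Away ξ →+* Localization.Away (φ ξ)) := by
  intro ξ
  have hσx : ∀ a : Fin n, σ (MvPolynomial.X (Sum.inl a)) =
      LaurentPolynomial.C (MvPolynomial.X (Sum.inl a)) * T 1 := fun a =>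
    hσ 1 _ (MvPolynomial.isWeightedHomogeneous_X _ _ _)
  have hσy : ∀ b : Fin n, σ (MvPolynomial.X (Sum.inr b)) =
      LaurentPolynomial.C (MvPolynomial.X (Sum.inr b)) * T (-1) := fun b =>
    hσ (-1) _ (MvPolynomial.isWeightedHomogeneous_X _ _ _)
  have hbal : ∀ c ∈ R₀, (c ⊗ₜ[↥R₀] 1 : MvPolynomial (Fin n ⊕ Fin n) k ⊗[↥R₀]
      MvPolynomial (Fin n ⊕ Fin n) k) = 1 ⊗ₜ[↥R₀] c := fun c hc => by
    have := TensorProduct.smul_tmul (R := ↥R₀) (⟨c, hc⟩ : ↥R₀)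
      (1 : MvPolynomial (Fin n ⊕ Fin n) k) (1 : MvPolynomial (Fin n ⊕ Fin n) k)
    simpa [Algebra.smul_def] using this
  have hXYmem : ∀ a b : Fin n, (MvPolynomial.X (Sum.inl a) * MvPolynomial.X (Sum.inr b) :
      MvPolynomial (Fin n ⊕ Fin n) k) ∈ R₀ := fun a b => by
    rw [← SetLike.mem_coe, hR₀]
    exact (MvPolynomial.isWeightedHomogeneous_X k _ _).mul
      (MvPolynomial.isWeightedHomogeneous_X k _ _)
  refine bijective_localizationAway_map φ ξ (fun t ht => ?_) (fun b => ?_) _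
  · have hξ : ξ = (Algebra.TensorProduct.includeLeft (R := ↥R₀) (S := ↥R₀)
          (B := MvPolynomial (Fin n ⊕ Fin n) k)).toRingHom (MvPolynomial.X (Sum.inl i)) *
        (Algebra.TensorProduct.includeRight (R := ↥R₀)
          (A := MvPolynomial (Fin n ⊕ Fin n) k)).toRingHom (MvPolynomial.X (Sum.inr j)) := by
      simp [ξ]
    rw [hξ]
    refine exists_pow_mul_eq_zero_of_map_eq_zero _ _
      (Algebra.TensorProduct.closure_range_union_range_eq_top ↥R₀ _ _)
      (fun c => hbal _ (R₀.algebraMap_mem c)) (fun a b => hbal _ (hXYmem a b))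
      ((Qsub σ).val.toRingHom.comp φ) (fun p => ?_) (fun a => ?_) (fun b => ?_) i j t ?_
    · exact (hφ p 1).trans (by simp)
    · exact (hφ 1 _).trans (by simp [hσx])
    · exact (hφ 1 _).trans (by simp [hσy])
    · simp [ht]
  · let S : Subring (LaurentPolynomial (MvPolynomial (Fin n ⊕ Fin n) k)) :=
      ((Qsub σ).val.toRingHom.comp φ).range
    have hmem : ∀ p q : MvPolynomial (Fin n ⊕ Fin n) k, LaurentPolynomial.C p * σ q ∈ S :=
      fun p q => ⟨p ⊗ₜ[↥R₀] q, hφ p q⟩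
    have hCmem : ∀ p, LaurentPolynomial.C p ∈ S := fun p => by simpa using hmem p 1
    have hs : ((φ ξ : ↥(Qsub σ)) : LaurentPolynomial (MvPolynomial (Fin n ⊕ Fin n) k)) ∈ S :=
      ⟨ξ, rfl⟩
    have hle := S.le_powSaturation _ hs
    have hb : (b : LaurentPolynomial (MvPolynomial (Fin n ⊕ Fin n) k)) ∈
        S.powSaturation _ hs := by
      refine Algebra.adjoin_induction (p := fun z _ => z ∈ S.powSaturation _ hs) ?_ ?_ ?_ ?_ b.2
      · rintro _ ((⟨p, rfl⟩ | ⟨q, rfl⟩) | rfl)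
        · exact hle (hCmem p)
        · exact hle (by simpa using hmem 1 q)
        · refine ⟨1, ?_⟩
          have : LaurentPolynomial.C (MvPolynomial.X (Sum.inl i)) *
              σ (MvPolynomial.X (Sum.inr j)) * T 1 =
              LaurentPolynomial.C 1 *
                σ (MvPolynomial.X (Sum.inl i) * MvPolynomial.X (Sum.inr j)) := by
            rw [map_mul, hσx, map_one]
            ring
          rw [pow_one, hφ, this]
          exact hmem _ _
      · exact fun c => hle (hCmem (algebraMap k _ c))
      · exact fun _ _ _ _ => add_mem
      · exact fun _ _ _ _ => mul_mem
    obtain ⟨N, a, ha⟩ := hb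
    exact ⟨N, a, Subtype.ext (by simpa using ha)⟩
end

section
/- Let R be a commutative ring with a ℤ-grading 𝒜 and let f ∈ 𝒜 1 be a homogeneous element of degree 1. Let R_f denote the localization of R away from f, and let (R_f)_0 denote its degree-zero part, the homogeneous localization of 𝒜 away from f. Then the ring homomorphism from the Laurent polynomial ring (R_f)_0[u,u⁻¹] to R_f, determined by the canonical inclusion (R_f)_0 → R_f on constants and by sending u to the image of f, is bijective. (Its inverse sends an element of R_f which is the image of a homogeneous element g of degree i to (g/fⁱ)·uⁱ.) -/
set_option synthInstance.maxHeartbeats 400000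
set_option maxHeartbeats 1000000

namespace HomogeneousLocalization.Away

variable {k A : Type*} [CommRing k] [CommRing A] [Algebra k A]
  {𝒜 : ℤ → Submodule k A} [GradedAlgebra 𝒜] {f : A}

/-- A homogeneous element of degree `n`, divided by `f ^ n`. -/
theorem exists_val_mul_pow_eq (hf : f ∈ 𝒜 1) (n : ℕ) {g : A} (hg : g ∈ 𝒜 n) :
    ∃ a : HomogeneousLocalization.Away 𝒜 f,
      a.val * algebraMap A (Localization.Away f) f ^ n =
        algebraMap A (Localization.Away f) g := by
  have hfn : f ^ n ∈ 𝒜 n := by simpa using SetLike.pow_mem_graded n hf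
  refine ⟨HomogeneousLocalization.mk ⟨n, ⟨g, hg⟩, ⟨f ^ n, hfn⟩, n, rfl⟩, ?_⟩
  rw [HomogeneousLocalization.val_mk, Localization.mk_eq_mk', ← map_pow]
  exact IsLocalization.mk'_spec _ _ _

/-- Every element of the homogeneous localization has denominator `f ^ m` for all large `m`. -/
theorem exists_forall_val_mul_pow_eq (hf : f ∈ 𝒜 1) (a : HomogeneousLocalization.Away 𝒜 f) :
    ∃ n : ℕ, ∀ m ≥ n, ∃ g ∈ 𝒜 m, a.val * algebraMap A (Localization.Away f) f ^ m =
      algebraMap A (Localization.Away f) g := by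
  obtain ⟨n, g, hg, rfl⟩ := HomogeneousLocalization.Away.mk_surjective 𝒜 hf a
  refine ⟨n, fun m hm => ?_⟩
  obtain ⟨l, rfl⟩ := Nat.exists_eq_add_of_le hm
  refine ⟨g * f ^ l, ?_, ?_⟩
  · simpa using SetLike.mul_mem_graded hg (SetLike.pow_mem_graded l hf)
  · rw [HomogeneousLocalization.Away.val_mk, Localization.mk_eq_mk', pow_add, ← mul_assoc, map_mul,
      map_pow, ← map_pow _ f n]
    congr 1
    exact IsLocalization.mk'_spec _ _ _

/-- The powers of a degree one element are linearly independent over the homogeneous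
localization. -/
theorem eq_zero_of_sum_val_mul_pow_eq_zero (hf : f ∈ 𝒜 1) (s : Finset ℕ)
    (a : ℕ → HomogeneousLocalization.Away 𝒜 f)
    (h : ∑ i ∈ s, (a i).val * algebraMap A (Localization.Away f) f ^ i = 0)
    {j : ℕ} (hj : j ∈ s) : a j = 0 := by
  have hpow (n : ℕ) : f ^ n ∈ 𝒜 n := by simpa using SetLike.pow_mem_graded n hf
  have hu : IsUnit (algebraMap A (Localization.Away f) f) :=
    IsLocalization.Away.algebraMap_isUnit f
  choose n hn using fun i => exists_forall_val_mul_pow_eq hf (a i)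
  choose! g hg hag using fun i (hi : i ∈ s) => hn i (s.sup n) (Finset.le_sup hi)
  set N := s.sup n
  have hsum : algebraMap A (Localization.Away f) (∑ i ∈ s, g i * f ^ i) = 0 := by
    rw [map_sum, ← zero_mul (algebraMap A (Localization.Away f) f ^ N), ← h, Finset.sum_mul]
    refine Finset.sum_congr rfl fun i hi => ?_
    rw [map_mul, ← hag i hi, map_pow]
    ring
  obtain ⟨⟨_, K, rfl⟩, hK⟩ :=
    (IsLocalization.map_eq_zero_iff (Submonoid.powers f) (Localization.Away f) _).1 hsum
  have hdeg : ∀ i ∈ s, f ^ K * (g i * f ^ i) ∈ 𝒜 (K + (N + i)) := fun i hi =>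
    SetLike.mul_mem_graded (hpow K) (SetLike.mul_mem_graded (hg i hi) (hpow i))
  have hzero : f ^ K * (g j * f ^ j) = 0 := by
    have := congrArg (GradedRing.proj 𝒜 (K + (N + j))) hK
    rw [Finset.mul_sum, map_sum, map_zero, Finset.sum_eq_single_of_mem j hj,
      GradedRing.proj_apply, DirectSum.decompose_of_mem_same 𝒜 (hdeg j hj)] at this
    · exact this
    · intro i hi hij
      rw [GradedRing.proj_apply]
      exact DirectSum.decompose_of_mem_ne 𝒜 (hdeg i hi) (by simpa using hij)
  apply HomogeneousLocalization.val_injective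
  rw [HomogeneousLocalization.val_zero]
  have := congrArg (algebraMap A (Localization.Away f)) hzero
  rw [map_mul, map_mul, ← hag j hj, map_pow, map_pow, map_zero] at this
  exact ((hu.pow N).mul_left_eq_zero).1
    (((hu.pow j).mul_left_eq_zero).1 (((hu.pow K).mul_right_eq_zero).1 this))

end HomogeneousLocalization.Away



/-- For `f` homogeneous of degree `1`, the ring homomorphism
`(R_f)₀[u,u⁻¹] → R_f` determined by the canonical inclusion of the homogeneous localization
`(R_f)₀ = HomogeneousLocalization.Away 𝒜 f` on constants and by `u ↦ f/1` is bijective. -/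
theorem stmt12 {k A : Type*} [CommRing k] [CommRing A] [Algebra k A]
    (𝒜 : ℤ → Submodule k A) [GradedAlgebra 𝒜]
    (f : A) (hf : f ∈ 𝒜 1)
    (Θ : LaurentPolynomial (HomogeneousLocalization.Away 𝒜 f) →+* Localization.Away f)
    (hΘC : ∀ a : HomogeneousLocalization.Away 𝒜 f,
      Θ (LaurentPolynomial.C a) = a.val)
    (hΘT : Θ (LaurentPolynomial.T 1) = algebraMap A (Localization.Away f) f) :
    Function.Bijective Θ := by
  have hT (n : ℕ) : Θ (LaurentPolynomial.T n) = algebraMap A (Localization.Away f) f ^ n := by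
    rw [← hΘT, ← map_pow, LaurentPolynomial.T_pow, mul_one]
  have hTneg (n : ℕ) :
      Θ (LaurentPolynomial.T (-n)) * algebraMap A (Localization.Away f) f ^ n = 1 := by
    rw [← hT, ← map_mul, ← LaurentPolynomial.T_add, neg_add_cancel, LaurentPolynomial.T_zero,
      map_one]
  constructor
  · rw [injective_iff_map_eq_zero]
    intro p hp
    obtain ⟨n, q, hq⟩ := p.exists_T_pow
    have hΘq : Θ (Polynomial.toLaurent q) = 0 := by rw [hq, map_mul, hp, zero_mul]
    have hq0 : q = 0 := by
      rw [q.as_sum_support_C_mul_X_pow, map_sum, map_sum] at hΘq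
      simp_rw [Polynomial.toLaurent_C_mul_X_pow, map_mul, hΘC, hT] at hΘq
      ext1 j
      by_cases hj : j ∈ q.support
      · exact HomogeneousLocalization.Away.eq_zero_of_sum_val_mul_pow_eq_zero hf _ _ hΘq hj
      · simpa using hj
    rw [hq0, map_zero] at hq
    exact ((LaurentPolynomial.isUnit_T n).mul_left_eq_zero).1 hq.symm
  · have hhom (i : ℤ) (g : A) (hg : g ∈ 𝒜 i) :
        algebraMap A (Localization.Away f) g ∈ Θ.range := by
      obtain ⟨m, n, hmn⟩ : ∃ m n : ℕ, i + m = n := ⟨(-i).toNat, i.toNat, by lia⟩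
      have hgm : g * f ^ m ∈ 𝒜 n := by
        rw [← hmn]
        exact SetLike.mul_mem_graded hg (by simpa using SetLike.pow_mem_graded m hf)
      obtain ⟨a, ha⟩ := HomogeneousLocalization.Away.exists_val_mul_pow_eq hf n hgm
      refine ⟨LaurentPolynomial.C a * LaurentPolynomial.T n * LaurentPolynomial.T (-m), ?_⟩
      rw [map_mul, map_mul, hΘC, hT, ha, map_mul, map_pow, mul_assoc, mul_comm (_ ^ m), hTneg,
        mul_one]
    intro z
    obtain ⟨a, ⟨_, n, rfl⟩, rfl⟩ := IsLocalization.exists_mk'_eq (Submonoid.powers f) z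
    have ha : algebraMap A (Localization.Away f) a ∈ Θ.range := by
      classical
      rw [← DirectSum.sum_support_decompose 𝒜 a, map_sum]
      exact sum_mem fun i _ => hhom i _ (SetLike.coe_mem _)
    obtain ⟨p, hp⟩ := ha
    refine ⟨p * LaurentPolynomial.T (-n), ?_⟩
    rw [IsLocalization.eq_mk'_iff_mul_eq, map_mul, map_pow, mul_assoc, hTneg, mul_one, hp]
end

section
/- Let R be a commutative ring with a ℤ-grading 𝒜, let R_{≥0} ⊆ R be the subring of elements all of whose homogeneous components of negative degree vanish, and let f ∈ 𝒜 1 be a homogeneous element of degree 1 (so f ∈ R_{≥0}). Then the ring homomorphism from the localization of R_{≥0} away from f to the localization of R away from f, induced by the inclusion R_{≥0} ⊆ R, is bijective; equivalently, R_f is the localization of R_{≥0} away from f. -/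
set_option synthInstance.maxHeartbeats 400000
set_option maxHeartbeats 1000000

/-- Multiplying by a high enough power of a degree-one element moves any element of a `ℤ`-graded
ring into nonnegative degrees. -/
theorem exists_pow_mul_mem_of_mem_degree_one {A : Type*} [CommRing A]
    (𝒜 : ℤ → AddSubgroup A) [GradedRing 𝒜] (Rpos : Subring A)
    (hRpos : ∀ x : A, x ∈ Rpos ↔
      ∀ i : ℤ, i < 0 → (DirectSum.decompose 𝒜 x i : A) = 0)
    {f : A} (hf1 : f ∈ 𝒜 1) (hfR : f ∈ Rpos) (x : A) :
    ∃ n : ℕ, f ^ n * x ∈ Rpos := by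
  induction x using DirectSum.Decomposition.inductionOn 𝒜 with
  | zero => exact ⟨0, by simp⟩
  | @homogeneous i a =>
    refine ⟨i.natAbs, (hRpos _).2 fun j hj => ?_⟩
    have hmem : f ^ i.natAbs * (a : A) ∈ 𝒜 (i.natAbs • (1 : ℤ) + i) :=
      SetLike.mul_mem_graded (SetLike.pow_mem_graded _ hf1) a.2
    refine DirectSum.decompose_of_mem_ne 𝒜 hmem ?_
    simp only [nsmul_eq_mul, mul_one]
    omega
  | add a b ha hb =>
    obtain ⟨n, hn⟩ := ha
    obtain ⟨m, hm⟩ := hb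
    refine ⟨n + m, ?_⟩
    have h : f ^ (n + m) * (a + b) = f ^ m * (f ^ n * a) + f ^ n * (f ^ m * b) := by ring
    rw [h]
    exact Rpos.add_mem (Rpos.mul_mem (Rpos.pow_mem hfR _) hn)
      (Rpos.mul_mem (Rpos.pow_mem hfR _) hm)

/-- With `R₊ = R_{≥0}` the subring of elements all of whose homogeneous
components of negative degree vanish, and `f` homogeneous of degree `1`, the map between the
localization of `R₊` away from `f` and the localization of `R` away from `f` induced by the
inclusion `R₊ ⊆ R` is bijective. -/
theorem stmt13 {A : Type*} [CommRing A]
    (𝒜 : ℤ → AddSubgroup A) [GradedRing 𝒜]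
    (Rpos : Subring A)
    (hRpos : ∀ x : A, x ∈ Rpos ↔
      ∀ i : ℤ, i < 0 → (DirectSum.decompose 𝒜 x i : A) = 0)
    (f : A) (hf1 : f ∈ 𝒜 1) (hfR : f ∈ Rpos) :
    Function.Bijective
      (IsLocalization.map
        (S := Localization.Away (⟨f, hfR⟩ : Rpos))
        (M := Submonoid.powers (⟨f, hfR⟩ : Rpos))
        (T := Submonoid.powers f)
        (Localization.Away f) Rpos.subtype
        (Submonoid.powers_le.mpr (Submonoid.mem_comap.mpr (Submonoid.mem_powers _))) :
        Localization.Away (⟨f, hfR⟩ : Rpos) →+* Localization.Away f) := by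
  constructor
  · rw [injective_iff_map_eq_zero]
    intro z hz
    obtain ⟨a, s, rfl⟩ :=
      IsLocalization.exists_mk'_eq (Submonoid.powers (⟨f, hfR⟩ : Rpos)) z
    rw [IsLocalization.map_mk', IsLocalization.mk'_eq_zero_iff] at hz
    obtain ⟨⟨_, n, rfl⟩, hn⟩ := hz
    rw [IsLocalization.mk'_eq_zero_iff]
    exact ⟨⟨_, n, rfl⟩, Subtype.ext hn⟩
  · intro z
    obtain ⟨x, ⟨_, m, rfl⟩, rfl⟩ := IsLocalization.exists_mk'_eq (Submonoid.powers f) z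
    obtain ⟨n, hn⟩ := exists_pow_mul_mem_of_mem_degree_one 𝒜 Rpos hRpos hf1 hfR x
    refine ⟨IsLocalization.mk' _ (⟨f ^ n * x, hn⟩ : Rpos)
      (⟨_, n + m, rfl⟩ : Submonoid.powers (⟨f, hfR⟩ : Rpos)), ?_⟩
    rw [IsLocalization.map_mk']
    refine IsLocalization.mk'_eq_of_eq ?_
    simp only [Subring.subtype_apply, map_pow]
    ring
end

section
/- Suppose C, L are exact (triangulated) endofunctors of T and (C, ε, δ, L) is a triangle system. Then the following are equivalent: (i) (L, δ) is a Bousfield localization and C(ε_x) = ε_{C x} for every object x; (ii) (C, ε) is a Bousfield colocalization and L(δ_x) = δ_{L x} for every object x. -/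
open CategoryTheory Limits Pretriangulated

universe v u

variable {T : Type u} [Category.{v} T] [HasZeroObject T] [HasShift T ℤ]
  [Preadditive T] [∀ n : ℤ, (shiftFunctor T n).Additive] [Pretriangulated T]

/-- `(C, ε, δ, L)` is a *triangle system* if for every object `x` there is a morphism
`ω_x : L x ⟶ (C x)⟦1⟧` making `C x ⟶ x ⟶ L x ⟶ (C x)⟦1⟧` a distinguished triangle. -/
def IsTriangleSystem (C L : T ⥤ T) (ε : C ⟶ 𝟭 T) (δ : 𝟭 T ⟶ L) : Prop :=
  ∀ x : T, ∃ ω : L.obj x ⟶ (C.obj x)⟦(1 : ℤ)⟧,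
    Triangle.mk (ε.app x) (δ.app x) ω ∈ distTriang T

/-- `(L, δ)` is a *Bousfield localization* if `L δ = δ L` and these maps are invertible. -/
def IsBousfieldLocalization (L : T ⥤ T) (δ : 𝟭 T ⟶ L) : Prop :=
  (∀ x : T, L.map (δ.app x) = δ.app (L.obj x)) ∧
    ∀ x : T, IsIso (L.map (δ.app x))

/-- `(C, ε)` is a *Bousfield colocalization* if `C ε = ε C` and these maps are invertible. -/
def IsBousfieldColocalization (C : T ⥤ T) (ε : C ⟶ 𝟭 T) : Prop :=
  (∀ x : T, C.map (ε.app x) = ε.app (C.obj x)) ∧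
    ∀ x : T, IsIso (C.map (ε.app x))

/-- If `δ` becomes invertible after applying `L`, then `ε` is invertible on the image of `C`. -/
theorem IsTriangleSystem.isIso_app_obj_of_isIso_map {C L : T ⥤ T} [L.CommShift ℤ]
    [L.IsTriangulated] {ε : C ⟶ 𝟭 T} {δ : 𝟭 T ⟶ L} (h : IsTriangleSystem C L ε δ) (x : T)
    (hx : IsIso (L.map (δ.app x))) : IsIso (ε.app (C.obj x)) := by
  obtain ⟨ω, hω⟩ := h x
  obtain ⟨ω', hω'⟩ := h (C.obj x)
  have hz : IsZero (L.obj (C.obj x)) :=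
    (Triangle.isZero₁_iff_isIso₂ _ (L.map_distinguished _ hω)).2 hx
  exact (Triangle.isZero₃_iff_isIso₁ _ hω').1 hz

/-- If `ε` becomes invertible after applying `C`, then `δ` is invertible on the image of `L`. -/
theorem IsTriangleSystem.isIso_app_obj_of_isIso_map' {C L : T ⥤ T} [C.CommShift ℤ]
    [C.IsTriangulated] {ε : C ⟶ 𝟭 T} {δ : 𝟭 T ⟶ L} (h : IsTriangleSystem C L ε δ) (x : T)
    (hx : IsIso (C.map (ε.app x))) : IsIso (δ.app (L.obj x)) := by
  obtain ⟨ω, hω⟩ := h x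
  obtain ⟨ω', hω'⟩ := h (L.obj x)
  have hz : IsZero (C.obj (L.obj x)) :=
    (Triangle.isZero₃_iff_isIso₁ _ (C.map_distinguished _ hω)).2 hx
  exact (Triangle.isZero₁_iff_isIso₂ _ hω').1 hz

/-- For a triangle system `(C, ε, δ, L)` with `C` and `L` exact, the
following are equivalent: (i) `(L, δ)` is a Bousfield localization and `C(ε_x) = ε_{C x}`
for all `x`; (ii) `(C, ε)` is a Bousfield colocalization and `L(δ_x) = δ_{L x}` for all `x`. -/
theorem stmt14 (C L : T ⥤ T) [C.CommShift ℤ] [L.CommShift ℤ]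
    [C.IsTriangulated] [L.IsTriangulated]
    (ε : C ⟶ 𝟭 T) (δ : 𝟭 T ⟶ L)
    (h : IsTriangleSystem C L ε δ) :
    (IsBousfieldLocalization L δ ∧ ∀ x : T, C.map (ε.app x) = ε.app (C.obj x)) ↔
    (IsBousfieldColocalization C ε ∧ ∀ x : T, L.map (δ.app x) = δ.app (L.obj x)) := by
  constructor
  · rintro ⟨⟨hL, hδ⟩, hC⟩
    exact ⟨⟨hC, fun x => (hC x).symm ▸ h.isIso_app_obj_of_isIso_map x (hδ x)⟩, hL⟩
  · rintro ⟨⟨hC, hε⟩, hL⟩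
    exact ⟨⟨hL, fun x => (hL x).symm ▸ h.isIso_app_obj_of_isIso_map' x (hε x)⟩, hC⟩
end

section
/- Suppose (C, ε, δ, L) is a Bousfield triangle, i.e. a triangle system in which (L, δ) is a Bousfield localization and (C, ε) is a Bousfield colocalization. Then for all objects x and y, every morphism C x ⟶ L y is zero. (Hence T admits a weak semi-orthogonal decomposition ⟨Im L, Im C⟩.) -/
open CategoryTheory Limits Pretriangulated

universe v u

variable {T : Type u} [Category.{v} T] [HasZeroObject T] [HasShift T ℤ]
  [Preadditive T] [∀ n : ℤ, (shiftFunctor T n).Additive] [Pretriangulated T]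

/-- If `(C, ε, δ, L)` is a Bousfield triangle (a triangle system which is
both a Bousfield localization and a Bousfield colocalization), then every morphism
`C x ⟶ L y` is zero; hence `T = ⟨Im L, Im C⟩` is a weak semi-orthogonal decomposition. -/
theorem stmt16 (C L : T ⥤ T) (ε : C ⟶ 𝟭 T) (δ : 𝟭 T ⟶ L)
    (h : IsTriangleSystem C L ε δ)
    (hL : IsBousfieldLocalization L δ)
    (hC : IsBousfieldColocalization C ε)
    (x y : T) (f : C.obj x ⟶ L.obj y) :
    f = 0 := by
  obtain ⟨ω, hω⟩ := h (C.obj x)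
  have hε : IsIso (ε.app (C.obj x)) := hC.1 x ▸ hC.2 x
  have hδ : IsIso (δ.app (L.obj y)) := hL.1 y ▸ hL.2 y
  have hz : IsZero (L.obj (C.obj x)) := (Triangle.isZero₃_iff_isIso₁ _ hω).2 hε
  have hnat : f ≫ δ.app (L.obj y) = δ.app (C.obj x) ≫ L.map f := δ.naturality f
  rw [← cancel_mono (δ.app (L.obj y)), hnat, zero_comp]
  exact (congrArg (· ≫ L.map f) (hz.eq_zero_of_tgt _)).trans zero_comp
end

section
/- Let (C₁, ε₁, δ₁, L₁) and (C₂, ε₂, δ₂, L₂) be two Bousfield triangles on T, with all four functors C₁, L₁, C₂, L₂ exact (triangulated) endofunctors. Assume that for every object x the morphism L₁(ε₂ at x) : L₁(C₂ x) ⟶ L₁ x is an isomorphism. Then for all objects M and N, every morphism C₂(C₁ M) ⟶ C₂(L₁ N) is zero. -/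
open CategoryTheory Limits Pretriangulated

universe v u

variable {T : Type u} [Category.{v} T] [HasZeroObject T] [HasShift T ℤ]
  [Preadditive T] [∀ n : ℤ, (shiftFunctor T n).Additive] [Pretriangulated T]

/-- In a triangle system whose `C` is a Bousfield colocalization, `L` kills the image of `C`. -/
theorem IsTriangleSystem.isZero_obj_obj {C L : T ⥤ T} {ε : C ⟶ 𝟭 T} {δ : 𝟭 T ⟶ L}
    (h : IsTriangleSystem C L ε δ) (hC : IsBousfieldColocalization C ε) (x : T) :
    IsZero (L.obj (C.obj x)) := by
  obtain ⟨ω, hω⟩ := h (C.obj x)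
  have : IsIso (ε.app (C.obj x)) := hC.1 x ▸ hC.2 x
  exact (Triangle.isZero₃_iff_isIso₁ _ hω).2 this

/-- A morphism from an object killed by a Bousfield localization to a local object is zero. -/
theorem IsBousfieldLocalization.eq_zero {L : T ⥤ T} {δ : 𝟭 T ⟶ L}
    (hL : IsBousfieldLocalization L δ) {x y : T} (hx : IsZero (L.obj x)) (g : x ⟶ L.obj y) :
    g = 0 := by
  have : IsIso (δ.app (L.obj y)) := hL.1 y ▸ hL.2 y
  have hg : g ≫ δ.app (L.obj y) = δ.app x ≫ L.map g := δ.naturality g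
  rw [← cancel_mono (δ.app (L.obj y)), hg, hx.eq_of_src (L.map g) 0, comp_zero, zero_comp]

/-- A morphism between colocal objects is zero as soon as its composition with the counit is. -/
theorem IsBousfieldColocalization.eq_zero_of_comp_eq_zero {C : T ⥤ T} [C.PreservesZeroMorphisms]
    {ε : C ⟶ 𝟭 T} (hC : IsBousfieldColocalization C ε) {x y : T} (f : C.obj x ⟶ C.obj y)
    (hf : f ≫ ε.app y = 0) : f = 0 := by
  have : IsIso (ε.app (C.obj x)) := hC.1 x ▸ hC.2 x
  have := hC.2 y
  have hCf : C.map f = 0 := by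
    rw [← cancel_mono (C.map (ε.app y)), zero_comp, ← C.map_comp]
    exact (congrArg C.map hf).trans (C.map_zero _ _)
  have hnat : C.map f ≫ ε.app (C.obj y) = ε.app (C.obj x) ≫ f := ε.naturality f
  rw [← cancel_epi (ε.app (C.obj x)), ← hnat, hCf, zero_comp, comp_zero]

/-- Given two Bousfield triangles `(C₁, ε₁, δ₁, L₁)` and
`(C₂, ε₂, δ₂, L₂)` with all four functors exact, and such that
`L₁(ε₂ at x) : L₁(C₂ x) ⟶ L₁ x` is an isomorphism for every `x`, every morphism
`C₂(C₁ M) ⟶ C₂(L₁ N)` is zero. -/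
theorem stmt17 (C₁ L₁ C₂ L₂ : T ⥤ T)
    [C₁.CommShift ℤ] [L₁.CommShift ℤ] [C₂.CommShift ℤ] [L₂.CommShift ℤ]
    [C₁.IsTriangulated] [L₁.IsTriangulated] [C₂.IsTriangulated] [L₂.IsTriangulated]
    (ε₁ : C₁ ⟶ 𝟭 T) (δ₁ : 𝟭 T ⟶ L₁) (ε₂ : C₂ ⟶ 𝟭 T) (δ₂ : 𝟭 T ⟶ L₂)
    (h₁ : IsTriangleSystem C₁ L₁ ε₁ δ₁)
    (hL₁ : IsBousfieldLocalization L₁ δ₁)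
    (hC₁ : IsBousfieldColocalization C₁ ε₁)
    (h₂ : IsTriangleSystem C₂ L₂ ε₂ δ₂)
    (hL₂ : IsBousfieldLocalization L₂ δ₂)
    (hC₂ : IsBousfieldColocalization C₂ ε₂)
    (hiso : ∀ x : T, IsIso (L₁.map (ε₂.app x)))
    (M N : T) (f : C₂.obj (C₁.obj M) ⟶ C₂.obj (L₁.obj N)) :
    f = 0 := by
  have := hiso (C₁.obj M)
  have hzero : IsZero (L₁.obj (C₂.obj (C₁.obj M))) :=
    (h₁.isZero_obj_obj hC₁ M).of_iso (asIso (L₁.map (ε₂.app (C₁.obj M))))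
  exact hC₂.eq_zero_of_comp_eq_zero f (hL₁.eq_zero hzero _)
end
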